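/- Let Γ be an icc countable group, let Γ↷^β X₀ be a pmp action, and let Γ↷X be an ergodic compact extension of β (in the sense of Furstenberg). Then for any intermediate von Neumann subalgebra L∞(X₀)⋊Γ ⊆ N ⊆ L∞(X)⋊Γ there exists an intermediate extension Γ↷Z between Γ↷X and Γ↷X₀ (i.e. Γ-equivariant factor maps π₁: X → Z and π₂: Z → X₀ with π₂∘π₁ = π) such that N = L∞(Z)⋊Γ. -/

import Mathlib

/-!
Common framework: we model tracial von Neumann algebras concretely, as von Neumann
algebras `M ⊆ B(H)` (Mathlib's `VonNeumannAlgebra H`, i.e. star-subalgebras equal to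
their double commutant) equipped with a faithful tracial state, and we model the
crossed product `A ⋊ Γ` of a trace-preserving action axiomatically: `M` contains a
copy of `A` and a group `(u γ)` of unitaries normalizing `A`, such that the canonical
trace-preserving conditional expectation `E_A` kills `u γ` for `γ ≠ 1`, and such that
an element of `M` all of whose Fourier coefficients `E_A (x (u γ)*)` vanish is `0`.
Probability-measure-preserving actions `Γ ↷ (X, μ)` are modelled via the associated
trace-preserving action on the abelian von Neumann algebra `A = L^∞(X)`.
-/

noncomputable section

open scoped Classical

namespace CD

/-- A group has infinite conjugacy classes (icc) if every nontrivial conjugacy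
class is infinite. -/
def IsICC (Γ : Type) [Group Γ] : Prop :=
  ∀ γ : Γ, γ ≠ 1 → {g : Γ | ∃ h : Γ, g = h * γ * h⁻¹}.Infinite

/-- A faithful tracial state on (the elements of) a set `M ⊆ B(H)` (in applications,
a von Neumann algebra), given as a globally defined linear functional whose
axioms are imposed on `M`. -/
structure TraceOn (H : Type) [NormedAddCommGroup H] [InnerProductSpace ℂ H] [CompleteSpace H]
    (M : Set (H →L[ℂ] H)) : Type where
  τ : (H →L[ℂ] H) →ₗ[ℂ] ℂ
  unital : τ 1 = 1
  tracial : ∀ x ∈ M, ∀ y ∈ M, τ (x * y) = τ (y * x)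
  star_eq : ∀ x ∈ M, τ (star x) = starRingEnd ℂ (τ x)
  nonneg : ∀ x ∈ M, 0 ≤ (τ (star x * x)).re ∧ (τ (star x * x)).im = 0
  faithful : ∀ x ∈ M, τ (star x * x) = 0 → x = 0

variable {H : Type} [NormedAddCommGroup H] [InnerProductSpace ℂ H] [CompleteSpace H]

/-- The 2-norm `‖x‖₂ = τ(x* x)^{1/2}` associated with a trace. -/
def TraceOn.norm2 {M : Set (H →L[ℂ] H)} (tr : TraceOn H M) (x : H →L[ℂ] H) : ℝ :=
  Real.sqrt (tr.τ (star x * x)).re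

/-- The (unique) trace-preserving conditional expectation from `M` onto a
von Neumann subalgebra `N ⊆ M`. -/
structure CondExpOn (H : Type) [NormedAddCommGroup H] [InnerProductSpace ℂ H] [CompleteSpace H]
    (M N : Set (H →L[ℂ] H)) (tr : TraceOn H M) : Type where
  E : (H →L[ℂ] H) →ₗ[ℂ] (H →L[ℂ] H)
  mem : ∀ x ∈ M, E x ∈ N
  fix : ∀ x ∈ N, E x = x
  bimod : ∀ a ∈ N, ∀ b ∈ N, ∀ x ∈ M, E (a * x * b) = a * E x * b
  star_map : ∀ x ∈ M, E (star x) = star (E x)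
  trace_eq : ∀ x ∈ M, tr.τ (E x) = tr.τ x
  contractive : ∀ x ∈ M, tr.norm2 (E x) ≤ tr.norm2 x

/-- The double commutant of a subset of `B(H)`: the von Neumann algebra
generated by `S` (for `S` a star-closed unital set). -/
def vnGen (S : Set (H →L[ℂ] H)) : Set (H →L[ℂ] H) :=
  Set.centralizer (Set.centralizer S)

/-- Model of the crossed product von Neumann algebra `M = A ⋊ Γ` of a
trace-preserving action `Γ ↷ (A, τ)`: `M` is generated by a copy of `A`
and canonical unitaries `(u γ)` implementing the action, with its canonical
conditional expectation `E_A` onto `A` (characterising the Fourier coefficients),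
together with the group von Neumann algebra `L(Γ) = {u γ : γ}'' ⊆ M` and the
conditional expectation onto it. -/
structure CrossedProduct (Γ : Type) [Group Γ]
    (H : Type) [NormedAddCommGroup H] [InnerProductSpace ℂ H] [CompleteSpace H] : Type where
  M : VonNeumannAlgebra H
  A : VonNeumannAlgebra H
  A_sub : (A : Set (H →L[ℂ] H)) ⊆ (M : Set (H →L[ℂ] H))
  tr : TraceOn H (M : Set (H →L[ℂ] H))
  u : Γ → (H →L[ℂ] H)
  u_mem : ∀ γ, u γ ∈ M
  u_one : u 1 = 1
  u_mul : ∀ γ δ, u γ * u δ = u (γ * δ)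
  u_star : ∀ γ, star (u γ) = u γ⁻¹
  conj_mem : ∀ (γ : Γ), ∀ a ∈ A, u γ * a * star (u γ) ∈ A
  EA : CondExpOn H (M : Set (H →L[ℂ] H)) (A : Set (H →L[ℂ] H)) tr
  EA_u : ∀ γ : Γ, γ ≠ 1 → EA.E (u γ) = 0
  fourier_sep : ∀ x ∈ M, (∀ γ : Γ, EA.E (x * star (u γ)) = 0) → x = 0
  Lg : VonNeumannAlgebra H
  Lg_eq : (Lg : Set (H →L[ℂ] H)) = vnGen (Set.range u)
  Lg_sub : (Lg : Set (H →L[ℂ] H)) ⊆ (M : Set (H →L[ℂ] H))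
  EL : CondExpOn H (M : Set (H →L[ℂ] H)) (Lg : Set (H →L[ℂ] H)) tr

variable {Γ : Type} [Group Γ]

/-- The action `σ_γ = Ad(u γ)` of `Γ` on `B(H)`, restricting to the given
action on `A`. -/
def CrossedProduct.σ (X : CrossedProduct Γ H) (γ : Γ) (x : H →L[ℂ] H) : H →L[ℂ] H :=
  X.u γ * x * star (X.u γ)

/-- The action is properly outer over the center of `P`; for abelian `P` this is
the usual freeness of the action. -/
def ProperlyOuterOn (X : CrossedProduct Γ H) (P : Set (H →L[ℂ] H)) : Prop :=
  ∀ γ : Γ, γ ≠ 1 → ∀ a ∈ P, (∀ b ∈ P, X.σ γ b * a = a * b) → a = 0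

/-- Freeness of the action `Γ ↷ A`. -/
def IsFree (X : CrossedProduct Γ H) : Prop := ProperlyOuterOn X (X.A : Set (H →L[ℂ] H))

/-- Ergodicity of the action `Γ ↷ A`: the fixed points are the scalars. -/
def IsErgodic (X : CrossedProduct Γ H) : Prop :=
  ∀ a ∈ X.A, (∀ γ : Γ, X.σ γ a = a) → ∃ c : ℂ, a = c • (1 : H →L[ℂ] H)

def IsAbelianSet (S : Set (H →L[ℂ] H)) : Prop := ∀ x ∈ S, ∀ y ∈ S, x * y = y * x

/-- `Q` is a `Γ`-invariant subset (in applications, subalgebra). -/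
def InvariantUnder (X : CrossedProduct Γ H) (Q : Set (H →L[ℂ] H)) : Prop :=
  ∀ (γ : Γ), ∀ q ∈ Q, X.σ γ q ∈ Q

/-- The intermediate crossed product `Q ⋊ Γ ⊆ A ⋊ Γ` of a (`Γ`-invariant)
subalgebra `Q ⊆ A`: those elements all of whose Fourier coefficients lie in `Q`. -/
def midCP (X : CrossedProduct Γ H) (Q : Set (H →L[ℂ] H)) : Set (H →L[ℂ] H) :=
  {x | x ∈ X.M ∧ ∀ γ : Γ, X.EA.E (x * star (X.u γ)) ∈ Q}

/-- The intermediate crossed product `A ⋊ K ⊆ A ⋊ Γ` of a subgroup `K ≤ Γ`: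
those elements whose Fourier coefficients are supported on `K`. -/
def subgpCP (X : CrossedProduct Γ H) (K : Subgroup Γ) : Set (H →L[ℂ] H) :=
  {x | x ∈ X.M ∧ ∀ γ : Γ, γ ∉ K → X.EA.E (x * star (X.u γ)) = 0}

/-- The quasinormalizer `QN_M(P)` of `P` inside `M`. -/
def QNset (M P : Set (H →L[ℂ] H)) : Set (H →L[ℂ] H) :=
  {x | x ∈ M ∧ ∃ (n : ℕ) (y : Fin n → (H →L[ℂ] H)), (∀ i, y i ∈ M) ∧
    (∀ p ∈ P, ∃ q : Fin n → (H →L[ℂ] H), (∀ i, q i ∈ P) ∧ p * x = ∑ i, y i * q i) ∧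
    (∀ p ∈ P, ∃ q : Fin n → (H →L[ℂ] H), (∀ i, q i ∈ P) ∧ x * p = ∑ i, q i * y i)}

def IsUnitaryIn (S : Set (H →L[ℂ] H)) (x : H →L[ℂ] H) : Prop :=
  x ∈ S ∧ star x * x = 1 ∧ x * star x = 1

def IsProjIn (S : Set (H →L[ℂ] H)) (p : H →L[ℂ] H) : Prop :=
  p ∈ S ∧ star p = p ∧ p * p = p

/-- The relative commutant `N' ∩ S`. -/
def commutantIn (N S : Set (H →L[ℂ] H)) : Set (H →L[ℂ] H) :=
  {x | x ∈ S ∧ ∀ y ∈ N, x * y = y * x}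

/-- Conjugation `w ( · ) w*` applied to a set. -/
def conjSet (w : H →L[ℂ] H) (S : Set (H →L[ℂ] H)) : Set (H →L[ℂ] H) :=
  (fun y => w * y * star w) '' S

/-- The scalars `ℂ 1 ⊆ B(H)`. -/
def scalars (H : Type) [NormedAddCommGroup H] [InnerProductSpace ℂ H] [CompleteSpace H] :
    Set (H →L[ℂ] H) :=
  Set.range (fun c : ℂ => c • (1 : H →L[ℂ] H))

/-- The extension `P₀ ⊆ P` of `Γ`-algebras is compact: there is a family `F ⊆ P`
with dense `‖·‖₂`-span in `P` such that the `Γ`-orbit of each `f ∈ F` can be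
uniformly approximated by finitely many "`P₀`-finite rank modules". -/
def IsCompactExt (X : CrossedProduct Γ H) (P₀ P : Set (H →L[ℂ] H)) : Prop :=
  ∃ F : Set (H →L[ℂ] H), F ⊆ P ∧
    (∀ p ∈ P, ∀ ε : ℝ, 0 < ε → ∃ (n : ℕ) (c : Fin n → ℂ) (f : Fin n → (H →L[ℂ] H)),
      (∀ i, f i ∈ F) ∧ X.tr.norm2 (p - ∑ i, c i • f i) ≤ ε) ∧
    (∀ f ∈ F, ∀ ε : ℝ, 0 < ε → ∃ (n : ℕ) (ξ : Fin n → (H →L[ℂ] H)) (C : ℝ),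
      (∀ i, ξ i ∈ P) ∧
      ∀ γ : Γ, ∃ κ : Fin n → (H →L[ℂ] H), (∀ i, κ i ∈ P₀) ∧ (∀ i, ‖κ i‖ ≤ C) ∧
        X.tr.norm2 (X.σ γ f - ∑ i, κ i * ξ i) ≤ ε)

/-- The action `Γ ↷ A` is compact: the extension over the scalars is compact. -/
def IsCompactAction (X : CrossedProduct Γ H) : Prop :=
  IsCompactExt X (scalars H) (X.A : Set (H →L[ℂ] H))

/-- The `Γ`-invariant subalgebra `B ⊆ A` gives a mixing extension: for
`t, z ∈ A ⊖ B` one has `‖E_B(t σ_γ(z))‖₂ → 0` as `γ → ∞`. -/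
def IsMixingExt (X : CrossedProduct Γ H) (B : Set (H →L[ℂ] H))
    (EB : CondExpOn H (X.M : Set (H →L[ℂ] H)) B X.tr) : Prop :=
  ∀ t ∈ X.A, ∀ z ∈ X.A, EB.E t = 0 → EB.E z = 0 →
    Filter.Tendsto (fun γ : Γ => X.tr.norm2 (EB.E (t * X.σ γ z))) Filter.cofinite (nhds 0)

/-- A `*`-isomorphism from (the von Neumann algebra with underlying set) `M ⊆ B(H₁)`
onto `N ⊆ B(H₂)`, given as a globally defined map with all axioms imposed on `M`. -/
structure StarIsoOn {H₁ : Type} [NormedAddCommGroup H₁] [InnerProductSpace ℂ H₁]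
    [CompleteSpace H₁] {H₂ : Type} [NormedAddCommGroup H₂] [InnerProductSpace ℂ H₂]
    [CompleteSpace H₂] (M : Set (H₁ →L[ℂ] H₁)) (N : Set (H₂ →L[ℂ] H₂)) : Type where
  Θ : (H₁ →L[ℂ] H₁) → (H₂ →L[ℂ] H₂)
  mem : ∀ x ∈ M, Θ x ∈ N
  map_one : Θ 1 = 1
  map_add : ∀ x ∈ M, ∀ y ∈ M, Θ (x + y) = Θ x + Θ y
  map_smul : ∀ (c : ℂ), ∀ x ∈ M, Θ (c • x) = c • Θ x
  map_mul : ∀ x ∈ M, ∀ y ∈ M, Θ (x * y) = Θ x * Θ y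
  map_star : ∀ x ∈ M, Θ (star x) = star (Θ x)
  inj : ∀ x ∈ M, ∀ y ∈ M, Θ x = Θ y → x = y
  surj : ∀ y ∈ N, ∃ x ∈ M, Θ x = y

/-- `r` is the (Pimsner–Popa/Jones) index of the inclusion `N ⊆ M`, witnessed by a
finite Pimsner–Popa basis `m₁, …, m_k` with `E_N (m_i m_j*) = δ_{ij} p_i`,
`x = ∑ᵢ E_N(x mᵢ*) mᵢ` for `x ∈ M`, and `r = ∑ᵢ τ(pᵢ)`. -/
def HasPPIndex {Mamb : Set (H →L[ℂ] H)} (tr : TraceOn H Mamb)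
    (M N : Set (H →L[ℂ] H)) (r : ℝ) : Prop :=
  ∃ E : (H →L[ℂ] H) →ₗ[ℂ] (H →L[ℂ] H),
    (∀ x ∈ M, E x ∈ N) ∧ (∀ x ∈ N, E x = x) ∧
    (∀ a ∈ N, ∀ b ∈ N, ∀ x ∈ M, E (a * x * b) = a * E x * b) ∧
    (∀ x ∈ M, tr.τ (E x) = tr.τ x) ∧
    ∃ (k : ℕ) (m p : Fin k → (H →L[ℂ] H)),
      (∀ i, m i ∈ M) ∧ (∀ i, p i ∈ N ∧ star (p i) = p i ∧ p i * p i = p i) ∧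
      (∀ i j, E (m i * star (m j)) = if i = j then p i else 0) ∧
      (∀ x ∈ M, x = ∑ i, E (x * star (m i)) * m i) ∧
      r = (∑ i, tr.τ (p i)).re

/-- The inclusion `N ⊆ M` has finite (Pimsner–Popa/Jones) index. -/
def FiniteIndexIn {Mamb : Set (H →L[ℂ] H)} (tr : TraceOn H Mamb)
    (M N : Set (H →L[ℂ] H)) : Prop :=
  ∃ r : ℝ, HasPPIndex tr M N r

/-- `S` (a von Neumann algebra) is a factor: trivial center. -/
def IsFactorSet (S : Set (H →L[ℂ] H)) : Prop :=
  ∀ x ∈ S, (∀ y ∈ S, x * y = y * x) → ∃ c : ℂ, x = c • (1 : H →L[ℂ] H)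

/-- `S` is a II₁ factor (with respect to the trace `tr`): a factor whose
projections realize every trace value in `[0,1]`. -/
def IsII1On {Mamb : Set (H →L[ℂ] H)} (tr : TraceOn H Mamb) (S : Set (H →L[ℂ] H)) : Prop :=
  IsFactorSet S ∧ ∀ r : ℝ, 0 ≤ r → r ≤ 1 →
    ∃ p ∈ S, star p = p ∧ p * p = p ∧ tr.τ p = (r : ℂ)

def IsFinDimSet (S : Set (H →L[ℂ] H)) : Prop :=
  ∃ (n : ℕ) (v : Fin n → (H →L[ℂ] H)), (∀ i, v i ∈ S) ∧
    ∀ x ∈ S, ∃ c : Fin n → ℂ, x = ∑ i, c i • v i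

def IsStarSubalgSet (S : Set (H →L[ℂ] H)) : Prop :=
  (1 : H →L[ℂ] H) ∈ S ∧ (∀ x ∈ S, ∀ y ∈ S, x + y ∈ S) ∧ (∀ x ∈ S, ∀ y ∈ S, x * y ∈ S) ∧
    (∀ (c : ℂ), ∀ x ∈ S, c • x ∈ S) ∧ (∀ x ∈ S, star x ∈ S)

/-- `S` is approximately finite dimensional (with respect to `‖·‖₂`); by Connes'
theorem this is equivalent to amenability for (separable, tracial) von Neumann
algebras. -/
def IsAFD {Mamb : Set (H →L[ℂ] H)} (tr : TraceOn H Mamb) (S : Set (H →L[ℂ] H)) : Prop :=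
  ∃ Q : ℕ → Set (H →L[ℂ] H), (∀ n, Q n ⊆ S) ∧ (∀ n, Q n ⊆ Q (n + 1)) ∧
    (∀ n, IsFinDimSet (Q n)) ∧ (∀ n, IsStarSubalgSet (Q n)) ∧
    ∀ x ∈ S, ∀ ε : ℝ, 0 < ε → ∃ n, ∃ y ∈ Q n, tr.norm2 (x - y) ≤ ε

/-- `S` is diffuse: it has no minimal projections. -/
def IsDiffuseSet (S : Set (H →L[ℂ] H)) : Prop :=
  ∀ p, IsProjIn S p → p ≠ 0 →
    ∃ q, IsProjIn S q ∧ q ≠ 0 ∧ q ≠ p ∧ q * p = q ∧ p * q = q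

/-- The (trace-preserving) action of `Γ` on the subalgebra `Q` is transitive:
`Q` is spanned by finitely many orthogonal minimal projections summing to `1`
which are permuted transitively by `Γ`. -/
def IsTransitiveOn (X : CrossedProduct Γ H) (Q : Set (H →L[ℂ] H)) : Prop :=
  ∃ (n : ℕ) (e : Fin n → (H →L[ℂ] H)),
    (∀ i, e i ∈ Q ∧ star (e i) = e i ∧ e i * e i = e i) ∧
    (∀ i j, i ≠ j → e i * e j = 0) ∧ (∑ i, e i = 1) ∧
    (∀ q ∈ Q, ∃ c : Fin n → ℂ, q = ∑ i, c i • e i) ∧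
    (∀ i j, ∃ γ : Γ, X.σ γ (e i) = e j)

/-- An abelian von Neumann algebra `S` is completely atomic: every nonzero
projection dominates a minimal projection. -/
def IsCompletelyAtomic (S : Set (H →L[ℂ] H)) : Prop :=
  ∀ p, IsProjIn S p → p ≠ 0 →
    ∃ q, IsProjIn S q ∧ q ≠ 0 ∧ q * p = q ∧
      ∀ r, IsProjIn S r → r * q = r → r = 0 ∨ r = q

end CD


namespace CD

section Basics

variable {H : Type} [NormedAddCommGroup H] [InnerProductSpace ℂ H] [CompleteSpace H]

open ContinuousLinearMap Filter Topology
open scoped InnerProductSpace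

lemma vn_mem_of_comm (M : VonNeumannAlgebra H) {x : H →L[ℂ] H}
    (h : ∀ y ∈ M.commutant, y * x = x * y) : x ∈ M := by
  rw [← M.commutant_commutant, VonNeumannAlgebra.mem_commutant_iff]
  exact h

lemma vn_comm (M : VonNeumannAlgebra H) {x y : H →L[ℂ] H} (hx : x ∈ M)
    (hy : y ∈ M.commutant) : y * x = x * y :=
  (VonNeumannAlgebra.mem_commutant_iff.1 hy x hx).symm

lemma vn_smul_mem (M : VonNeumannAlgebra H) (c : ℂ) {x : H →L[ℂ] H} (hx : x ∈ M) :
    c • x ∈ M :=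
  M.toStarSubalgebra.smul_mem hx c

lemma vn_rsmul_mem (M : VonNeumannAlgebra H) (c : ℝ) {x : H →L[ℂ] H} (hx : x ∈ M) :
    c • x ∈ M := by
  have := vn_smul_mem M (c : ℂ) hx
  simpa using this

lemma vn_cfc_mem (M : VonNeumannAlgebra H) (f : ℝ → ℝ) {x : H →L[ℂ] H} (hx : x ∈ M) :
    cfc f x ∈ M := by
  refine vn_mem_of_comm M fun y hy => ?_
  have h1 : Commute x y := (vn_comm M hx hy).symm
  exact (h1.cfc_real f).eq.symm

lemma vn_sqrt (M : VonNeumannAlgebra H) {x : H →L[ℂ] H} (hx : x ∈ M) (h0 : 0 ≤ x) :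
    ∃ s ∈ M, 0 ≤ s ∧ star s = s ∧ s * s = x := by
  refine ⟨cfc Real.sqrt x, vn_cfc_mem M _ hx, cfc_nonneg fun t _ => Real.sqrt_nonneg t, ?_, ?_⟩
  · exact (cfc_predicate Real.sqrt x : IsSelfAdjoint _)
  · have hsa : IsSelfAdjoint x := IsSelfAdjoint.of_nonneg h0
    rw [← cfc_mul Real.sqrt Real.sqrt x]
    conv_rhs => rw [← cfc_id ℝ x]
    refine cfc_congr fun t ht => ?_
    have : 0 ≤ t := spectrum_nonneg_of_nonneg h0 ht
    simp [Real.mul_self_sqrt this]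

/-- Projection onto an `M'`-invariant closed subspace lies in `M`. -/
lemma vn_proj_mem (M : VonNeumannAlgebra H) (K : Submodule ℂ H) [K.HasOrthogonalProjection]
    (hK : ∀ y ∈ M.commutant, ∀ v ∈ K, y v ∈ K) : K.starProjection ∈ M := by
  have hp : IsStarProjection K.starProjection := isStarProjection_starProjection
  rw [VonNeumannAlgebra.IsStarProjection.mem_iff hp]
  intro y hy v hv
  simp only [Submodule.range_starProjection] at hv ⊢
  exact hK y hy v hv

lemma vn_rangeProj (M : VonNeumannAlgebra H) {x : H →L[ℂ] H} (hx : x ∈ M) :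
    ∃ e ∈ M, star e = e ∧ e * e = e ∧ e * x = x ∧ (∀ y : H →L[ℂ] H, y * x = 0 → y * e = 0) ∧
      (∀ v, e v ∈ closure (Set.range x)) := by
  let K : Submodule ℂ H := x.range.topologicalClosure
  have hKc : (K : Set H) = closure (Set.range x) := by
    rw [Submodule.topologicalClosure_coe]; rfl
  have : CompleteSpace K := Submodule.topologicalClosure.completeSpace _
  have hp : IsStarProjection K.starProjection := isStarProjection_starProjection
  refine ⟨K.starProjection, ?_, hp.isSelfAdjoint, hp.isIdempotentElem, ?_, ?_, ?_⟩
  · refine vn_proj_mem M K fun y hy v hv => ?_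
    have hv' : v ∈ closure (Set.range x) := by rw [← hKc]; exact hv
    change y v ∈ (K : Set H)
    rw [hKc]
    refine map_mem_closure y.continuous hv' ?_
    rintro _ ⟨w, rfl⟩
    refine ⟨y w, ?_⟩
    have := congrArg (fun T : H →L[ℂ] H => T w) (vn_comm M hx hy)
    simpa using this.symm
  · ext v
    have : x v ∈ K := Submodule.le_topologicalClosure _ ⟨v, rfl⟩
    simpa using Submodule.starProjection_eq_self_iff.2 this
  · intro y hy
    ext v
    have h1 : K.starProjection v ∈ closure (Set.range x) := by
      rw [← hKc]; exact Submodule.starProjection_apply_mem _ _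
    have h2 : closure (Set.range x) ⊆ {w | y w = 0} := by
      refine closure_minimal ?_ (isClosed_eq y.continuous continuous_const)
      rintro _ ⟨w, rfl⟩
      have := congrArg (fun T : H →L[ℂ] H => T w) hy
      simpa using this
    simpa using h2 h1
  · intro v
    rw [← hKc]; exact Submodule.starProjection_apply_mem _ _

open ContinuousLinearMapWOT in
lemma wot_ball_compact : IsCompact {T : H →WOT[ℂ] H | ‖T.toCLM‖ ≤ 1} := by
  rw [isCompact_iff_ultrafilter_le_nhds]
  intro U hU
  have hU' : ∀ᶠ T in (U : Filter (H →WOT[ℂ] H)), ‖T.toCLM‖ ≤ 1 := le_principal_iff.1 hU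
  have hb : ∀ v w : H, ∀ᶠ T in (U : Filter (H →WOT[ℂ] H)), ‖⟪T v, w⟫_ℂ‖ ≤ 1 * ‖v‖ * ‖w‖ := by
    intro v w
    filter_upwards [hU'] with T hT
    refine (norm_inner_le_norm _ _).trans ?_
    have : ‖T v‖ ≤ 1 * ‖v‖ := (T.toCLM.le_opNorm v).trans (by gcongr)
    gcongr
  have hlim : ∀ v w : H, ∃ z : ℂ, ‖z‖ ≤ 1 * ‖v‖ * ‖w‖ ∧
      Tendsto (fun T : H →WOT[ℂ] H => ⟪T v, w⟫_ℂ) U (𝓝 z) := by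
    intro v w
    have hc : IsCompact (Metric.closedBall (0 : ℂ) (1 * ‖v‖ * ‖w‖)) := isCompact_closedBall _ _
    obtain ⟨z, hz, hz2⟩ := isCompact_iff_ultrafilter_le_nhds.1 hc
      (U.map (fun T : H →WOT[ℂ] H => ⟪T v, w⟫_ℂ)) (by
        simp only [le_principal_iff, Ultrafilter.coe_map, mem_map]
        filter_upwards [hb v w] with T hT
        simpa using hT)
    exact ⟨z, by simpa using hz, hz2⟩
  choose B hB1 hB2 using hlim
  let f : H →ₗ⋆[ℂ] H →ₗ[ℂ] ℂ := LinearMap.mk₂'ₛₗ (starRingEnd ℂ) (RingHom.id ℂ) B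
    (fun v v' w => tendsto_nhds_unique (hB2 (v + v') w) (by
      simpa [inner_add_left] using (hB2 v w).add (hB2 v' w)))
    (fun c v w => tendsto_nhds_unique (hB2 (c • v) w) (by
      simpa [inner_smul_left, mul_comm] using (hB2 v w).const_mul (starRingEnd ℂ c)))
    (fun v w w' => tendsto_nhds_unique (hB2 v (w + w')) (by
      simpa [inner_add_right] using (hB2 v w).add (hB2 v w')))
    (fun c v w => tendsto_nhds_unique (hB2 v (c • w)) (by
      simpa [inner_smul_right] using (hB2 v w).const_mul c))
  let F := f.mkContinuous₂ 1 hB1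
  let S : H →L[ℂ] H := InnerProductSpace.continuousLinearMapOfBilin F
  have hS : ∀ v w, ⟪S v, w⟫_ℂ = B v w := fun v w =>
    InnerProductSpace.continuousLinearMapOfBilin_apply F v w
  refine ⟨ContinuousLinearMapWOT.ofCLM S, ?_, ?_⟩
  · refine ContinuousLinearMap.opNorm_le_bound _ zero_le_one fun v => ?_
    change ‖S v‖ ≤ 1 * ‖v‖
    by_cases h : ‖S v‖ = 0
    · rw [h]; positivity
    · have h1 := hB1 v (S v)
      rw [← hS, inner_self_eq_norm_sq_to_K] at h1
      have h2 : ‖S v‖ * ‖S v‖ ≤ 1 * ‖v‖ * ‖S v‖ := by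
        simpa [pow_two] using h1
      exact le_of_mul_le_mul_right h2 (lt_of_le_of_ne (norm_nonneg _) (Ne.symm h))
  · rw [ContinuousLinearMapWOT.le_nhds_iff_forall_inner_apply_le_nhds]
    intro v w
    have h1 : Tendsto (fun T : H →WOT[ℂ] H => starRingEnd ℂ ⟪T v, w⟫_ℂ) U
        (𝓝 (starRingEnd ℂ (B v w))) := (Complex.continuous_conj.tendsto _).comp (hB2 v w)
    rw [← hS] at h1
    have h2 : Tendsto (fun T : H →WOT[ℂ] H => ⟪w, T v⟫_ℂ) U (𝓝 ⟪w, S v⟫_ℂ) := by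
      simpa using h1
    exact h2

lemma wot_continuous_inner (v w : H) :
    Continuous (fun T : H →WOT[ℂ] H => ⟪w, T v⟫_ℂ) := by
  have := (ContinuousLinearMapWOT.continuous_iff (f := fun T : H →WOT[ℂ] H => T)).1 continuous_id
  exact this v w

lemma wot_isClosed_vn (M : VonNeumannAlgebra H) :
    IsClosed {T : H →WOT[ℂ] H | T.toCLM ∈ M} := by
  have : {T : H →WOT[ℂ] H | T.toCLM ∈ M} =
      ⋂ y ∈ M.commutant, {T : H →WOT[ℂ] H | ∀ v w, ⟪w, y (T v)⟫_ℂ = ⟪w, T (y v)⟫_ℂ} := by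
    ext T
    simp only [Set.mem_ofPred_eq, Set.mem_iInter]
    constructor
    · intro h y hy v w
      have := congrArg (fun T : H →L[ℂ] H => T v) (vn_comm M h hy)
      have h2 : y (T v) = T (y v) := this
      rw [h2]
    · intro h
      refine vn_mem_of_comm M fun y hy => ?_
      ext v
      exact ext_inner_left ℂ fun w => h y hy v w
  rw [this]
  refine isClosed_biInter fun y _ => ?_
  simp only [Set.ofPred_forall]
  refine isClosed_iInter fun v => isClosed_iInter fun w => ?_
  refine isClosed_eq ?_ (wot_continuous_inner _ _)
  have : (fun T : H →WOT[ℂ] H => ⟪w, y (T v)⟫_ℂ) =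
      fun T : H →WOT[ℂ] H => ⟪ContinuousLinearMap.adjoint y w, T v⟫_ℂ := by
    ext T
    rw [ContinuousLinearMap.adjoint_inner_left]
  rw [this]
  exact wot_continuous_inner _ _

lemma wot_isClosed_nonneg : IsClosed {T : H →WOT[ℂ] H | 0 ≤ T.toCLM} := by
  have : {T : H →WOT[ℂ] H | 0 ≤ T.toCLM} =
      ⋂ v : H, {T : H →WOT[ℂ] H | 0 ≤ (⟪v, T v⟫_ℂ).re ∧ (⟪v, T v⟫_ℂ).im = 0} := by
    ext T
    simp only [Set.mem_ofPred_eq, Set.mem_iInter, ContinuousLinearMap.nonneg_iff_isPositive]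
    rw [ContinuousLinearMap.isPositive_iff']
    constructor
    · rintro ⟨h1, h2⟩ v
      have h3 := h2 v
      have h4 : ⟪v, T v⟫_ℂ = starRingEnd ℂ ⟪T.toCLM v, v⟫_ℂ := (inner_conj_symm _ _).symm
      rw [h4]
      rw [Complex.nonneg_iff] at h3
      simp only [Complex.conj_re, Complex.conj_im]
      exact ⟨h3.1, by rw [← h3.2]; simp⟩
    · intro h
      have h0 : T.toCLM.IsPositive := by
        rw [ContinuousLinearMap.isPositive_iff_complex]
        intro v
        have h4 : ⟪T.toCLM v, v⟫_ℂ = starRingEnd ℂ ⟪v, T v⟫_ℂ := (inner_conj_symm _ _).symm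
        rw [h4]
        have h5 := h v
        revert h5
        generalize ⟪v, T v⟫_ℂ = z
        intro h5
        refine ⟨?_, ?_⟩
        · apply Complex.ext <;> simp [h5.2]
        · simpa using h5.1
      exact (ContinuousLinearMap.isPositive_iff' _).1 h0
  rw [this]
  refine isClosed_iInter fun v => ?_
  refine IsClosed.inter ?_ ?_
  · exact isClosed_le continuous_const (Complex.continuous_re.comp (wot_continuous_inner _ _))
  · exact isClosed_eq (Complex.continuous_im.comp (wot_continuous_inner _ _)) continuous_const

lemma wot_isClosed_le (a : H →L[ℂ] H) : IsClosed {T : H →WOT[ℂ] H | a ≤ T.toCLM} := by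
  have h := wot_isClosed_nonneg (H := H)
  have h2 : Continuous (fun T : H →WOT[ℂ] H => T - ContinuousLinearMapWOT.ofCLM a) :=
    continuous_id.sub continuous_const
  have := h.preimage h2
  convert this using 1
  ext T
  simp

lemma wot_isClosed_ge (a : H →L[ℂ] H) : IsClosed {T : H →WOT[ℂ] H | T.toCLM ≤ a} := by
  have h := wot_isClosed_nonneg (H := H)
  have h2 : Continuous (fun T : H →WOT[ℂ] H => ContinuousLinearMapWOT.ofCLM a - T) :=
    continuous_const.sub continuous_id
  have := h.preimage h2
  convert this using 1
  ext T
  simp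

lemma norm_le_one_of_Icc {x : H →L[ℂ] H} (h0 : 0 ≤ x) (h1 : x ≤ 1) : ‖x‖ ≤ 1 :=
  (CStarAlgebra.norm_le_one_iff_of_nonneg x h0).2 h1

lemma wot_Icc_compact (M : VonNeumannAlgebra H) :
    IsCompact {T : H →WOT[ℂ] H | T.toCLM ∈ M ∧ 0 ≤ T.toCLM ∧ T.toCLM ≤ 1} := by
  refine wot_ball_compact.of_isClosed_subset ?_ ?_
  · exact (wot_isClosed_vn M).inter (wot_isClosed_nonneg.inter (wot_isClosed_ge 1))
  · rintro T ⟨_, h0, h1⟩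
    exact norm_le_one_of_Icc h0 h1

end Basics

end CD

namespace CD

section Trace

variable {H : Type} [NormedAddCommGroup H] [InnerProductSpace ℂ H] [CompleteSpace H]

open ContinuousLinearMap Filter Topology
open scoped InnerProductSpace

variable {M : VonNeumannAlgebra H}

lemma vn_star_mem (M : VonNeumannAlgebra H) {x : H →L[ℂ] H} (hx : x ∈ M) : star x ∈ M :=
  star_mem hx

lemma tr_nonneg (tr : TraceOn H (M : Set (H →L[ℂ] H))) {x : H →L[ℂ] H} (hx : x ∈ M)
    (h0 : 0 ≤ x) : 0 ≤ (tr.τ x).re := by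
  obtain ⟨s, hs, _, hss, rfl⟩ := vn_sqrt M hx h0
  have := (tr.nonneg s hs).1
  rwa [hss] at this

lemma tr_im (tr : TraceOn H (M : Set (H →L[ℂ] H))) {x : H →L[ℂ] H} (hx : x ∈ M)
    (h0 : star x = x) : (tr.τ x).im = 0 := by
  have := tr.star_eq x hx
  rw [h0] at this
  exact Complex.conj_eq_iff_im.1 this.symm

lemma tr_mono (tr : TraceOn H (M : Set (H →L[ℂ] H))) {x y : H →L[ℂ] H} (hx : x ∈ M)
    (hy : y ∈ M) (h0 : x ≤ y) : (tr.τ x).re ≤ (tr.τ y).re := by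
  have := tr_nonneg tr (sub_mem hy hx) (sub_nonneg.2 h0)
  simpa using this

lemma tr_pos_eq_zero (tr : TraceOn H (M : Set (H →L[ℂ] H))) {x : H →L[ℂ] H} (hx : x ∈ M)
    (h0 : 0 ≤ x) (h : (tr.τ x).re ≤ 0) : x = 0 := by
  have h1 : tr.τ x = 0 := by
    apply Complex.ext
    · simpa using le_antisymm h (tr_nonneg tr hx h0)
    · simpa using tr_im tr hx (IsSelfAdjoint.of_nonneg h0)
  obtain ⟨s, hs, _, hss, rfl⟩ := vn_sqrt M hx h0
  have : s = 0 := tr.faithful s hs (by rwa [hss])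
  simp [this]

lemma norm2_nonneg (tr : TraceOn H (M : Set (H →L[ℂ] H))) (x : H →L[ℂ] H) :
    0 ≤ tr.norm2 x := Real.sqrt_nonneg _

lemma norm2_sq (tr : TraceOn H (M : Set (H →L[ℂ] H))) {x : H →L[ℂ] H} (hx : x ∈ M) :
    tr.norm2 x ^ 2 = (tr.τ (star x * x)).re :=
  Real.sq_sqrt (tr.nonneg x hx).1

lemma norm2_sq_c (tr : TraceOn H (M : Set (H →L[ℂ] H))) {x : H →L[ℂ] H} (hx : x ∈ M) :
    ((tr.norm2 x ^ 2 : ℝ) : ℂ) = tr.τ (star x * x) := by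
  rw [norm2_sq tr hx]
  apply Complex.ext
  · simp
  · simpa using (tr.nonneg x hx).2.symm

lemma norm2_eq_zero (tr : TraceOn H (M : Set (H →L[ℂ] H))) {x : H →L[ℂ] H} (hx : x ∈ M)
    (h : tr.norm2 x = 0) : x = 0 := by
  refine tr.faithful x hx ?_
  rw [← norm2_sq_c tr hx, h]; simp

lemma norm2_zero (tr : TraceOn H (M : Set (H →L[ℂ] H))) : tr.norm2 0 = 0 := by
  simp [TraceOn.norm2]

/-- The pre-inner product given by the trace. -/
@[reducible]
def trCore (tr : TraceOn H (M : Set (H →L[ℂ] H))) :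
    PreInnerProductSpace.Core ℂ M.toStarSubalgebra where
  inner x y := tr.τ (star (x : H →L[ℂ] H) * (y : H →L[ℂ] H))
  conj_inner_symm x y := by
    rw [← tr.star_eq]
    · simp
    · exact mul_mem (star_mem y.2) x.2
  re_inner_nonneg x := (tr.nonneg x x.2).1
  add_left x y z := by simp [add_mul]
  smul_left x y r := by simp

lemma tr_cs (tr : TraceOn H (M : Set (H →L[ℂ] H))) {x y : H →L[ℂ] H} (hx : x ∈ M)
    (hy : y ∈ M) : ‖tr.τ (star x * y)‖ ≤ tr.norm2 x * tr.norm2 y := by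
  let c := trCore tr
  have h := @InnerProductSpace.Core.inner_mul_inner_self_le ℂ M.toStarSubalgebra _ _ _ c
    ⟨x, hx⟩ ⟨y, hy⟩
  change ‖tr.τ (star x * y)‖ * ‖tr.τ (star y * x)‖ ≤
    (tr.τ (star x * x)).re * (tr.τ (star y * y)).re at h
  have h2 : ‖tr.τ (star y * x)‖ = ‖tr.τ (star x * y)‖ := by
    have := tr.star_eq (star x * y) (mul_mem (star_mem hx) hy)
    rw [star_mul, star_star] at this
    rw [this]; simp
  rw [h2, ← norm2_sq tr hx, ← norm2_sq tr hy] at h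
  refine le_of_sq_le_sq ?_ (mul_nonneg (norm2_nonneg _ _) (norm2_nonneg _ _))
  nlinarith

lemma norm2_add_le (tr : TraceOn H (M : Set (H →L[ℂ] H))) {x y : H →L[ℂ] H} (hx : x ∈ M)
    (hy : y ∈ M) : tr.norm2 (x + y) ≤ tr.norm2 x + tr.norm2 y := by
  have h1 : tr.norm2 (x + y) ^ 2 = tr.norm2 x ^ 2 + tr.norm2 y ^ 2 +
      (tr.τ (star x * y)).re + (tr.τ (star y * x)).re := by
    rw [norm2_sq tr hx, norm2_sq tr hy, norm2_sq tr (add_mem hx hy)]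
    simp [add_mul, mul_add]; ring
  have h2 := (Complex.re_le_norm _).trans (tr_cs tr hx hy)
  have h3 := (Complex.re_le_norm _).trans (tr_cs tr hy hx)
  have := norm2_nonneg tr x
  have := norm2_nonneg tr y
  refine le_of_sq_le_sq ?_ (by positivity)
  nlinarith

lemma norm2_smul (tr : TraceOn H (M : Set (H →L[ℂ] H))) (c : ℂ) {x : H →L[ℂ] H} (hx : x ∈ M) :
    tr.norm2 (c • x) = ‖c‖ * tr.norm2 x := by
  have h1 : tr.norm2 (c • x) ^ 2 = (‖c‖ * tr.norm2 x) ^ 2 := by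
    rw [norm2_sq tr (vn_smul_mem M c hx), mul_pow, norm2_sq tr hx]
    have : tr.τ (star (c • x) * (c • x)) = ((‖c‖ ^ 2 : ℝ) : ℂ) * tr.τ (star x * x) := by
      simp only [star_smul, smul_mul_assoc, mul_smul_comm, map_smul, smul_eq_mul, ← mul_assoc]
      congr 1
      rw [mul_comm]
      simpa using Complex.conj_mul' c
    rw [this, Complex.re_ofReal_mul]
  have := norm2_nonneg tr x
  exact (pow_left_inj₀ (norm2_nonneg _ _) (by positivity) two_ne_zero).1 h1

lemma norm2_neg (tr : TraceOn H (M : Set (H →L[ℂ] H))) (x : H →L[ℂ] H) :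
    tr.norm2 (-x) = tr.norm2 x := by
  simp [TraceOn.norm2]

lemma norm2_sub_le (tr : TraceOn H (M : Set (H →L[ℂ] H))) {x y : H →L[ℂ] H} (hx : x ∈ M)
    (hy : y ∈ M) : tr.norm2 (x - y) ≤ tr.norm2 x + tr.norm2 y := by
  rw [sub_eq_add_neg, ← norm2_neg tr y]
  exact norm2_add_le tr hx (neg_mem hy)

lemma norm2_sum_le (tr : TraceOn H (M : Set (H →L[ℂ] H))) {ι : Type*} (s : Finset ι)
    (f : ι → H →L[ℂ] H) (hf : ∀ i, f i ∈ M) :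
    tr.norm2 (∑ i ∈ s, f i) ≤ ∑ i ∈ s, tr.norm2 (f i) := by
  induction s using Finset.induction_on with
  | empty => simp [norm2_zero]
  | insert a s ha ih =>
    rw [Finset.sum_insert ha, Finset.sum_insert ha]
    refine (norm2_add_le tr (hf a) (sum_mem fun i _ => hf i)).trans ?_
    gcongr

lemma vn_rsmul_one_mem (M : VonNeumannAlgebra H) (c : ℝ) : c • (1 : H →L[ℂ] H) ∈ M :=
  vn_rsmul_mem M c (one_mem M)

lemma tr_rsmul (tr : TraceOn H (M : Set (H →L[ℂ] H))) (c : ℝ) (x : H →L[ℂ] H) :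
    tr.τ (c • x) = (c : ℂ) * tr.τ x := by
  rw [← smul_eq_mul, ← map_smul]
  congr 1

lemma norm2_mul_le (tr : TraceOn H (M : Set (H →L[ℂ] H))) {k x : H →L[ℂ] H} (hk : k ∈ M)
    (hx : x ∈ M) : tr.norm2 (k * x) ≤ ‖k‖ * tr.norm2 x := by
  have h1 : star k * k ≤ algebraMap ℝ (H →L[ℂ] H) (‖k‖ ^ 2) :=
    CStarAlgebra.star_mul_le_algebraMap_norm_sq
  have h2 := star_left_conjugate_le_conjugate h1 x
  have h3 := tr_mono tr (mul_mem (mul_mem (star_mem hx) (mul_mem (star_mem hk) hk)) hx) ?_ h2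
  · refine le_of_sq_le_sq ?_ (mul_nonneg (norm_nonneg _) (norm2_nonneg _ _))
    rw [mul_pow, norm2_sq tr (mul_mem hk hx), norm2_sq tr hx]
    have e1 : star (k * x) * (k * x) = star x * (star k * k) * x := by
      simp [mul_assoc]
    rw [e1]
    refine h3.trans (le_of_eq ?_)
    rw [Algebra.algebraMap_eq_smul_one, mul_smul_comm, mul_one, smul_mul_assoc]
    rw [tr_rsmul, Complex.re_ofReal_mul]
  · rw [Algebra.algebraMap_eq_smul_one]
    exact mul_mem (mul_mem (star_mem hx) (vn_rsmul_one_mem M _)) hx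

lemma norm2_star (tr : TraceOn H (M : Set (H →L[ℂ] H))) {x : H →L[ℂ] H} (hx : x ∈ M) :
    tr.norm2 (star x) = tr.norm2 x := by
  rw [TraceOn.norm2, TraceOn.norm2, star_star, tr.tracial x hx _ (star_mem hx)]

lemma tr_sep (tr : TraceOn H (M : Set (H →L[ℂ] H))) {x : H →L[ℂ] H} (hx : x ∈ M)
    (h : ∀ y ∈ M, tr.τ (x * y) = 0) : x = 0 := by
  refine tr.faithful x hx ?_
  rw [tr.tracial _ (star_mem hx) _ hx]
  exact h _ (star_mem hx)

/-- unitary invariance -/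
lemma norm2_conj (tr : TraceOn H (M : Set (H →L[ℂ] H))) {u x : H →L[ℂ] H} (hu : u ∈ M)
    (hx : x ∈ M) (huu : star u * u = 1) : tr.norm2 (u * x * star u) = tr.norm2 x := by
  have h : tr.τ (star (u * x * star u) * (u * x * star u)) = tr.τ (star x * x) := by
    have e : star (u * x * star u) * (u * x * star u) = (u * (star x * x)) * star u := by
      have : star (u * x * star u) * (u * x * star u) =
        u * star x * (star u * u) * x * star u := by simp [mul_assoc]
      rw [this, huu]; simp [mul_assoc]
    rw [e, tr.tracial _ (mul_mem hu (mul_mem (star_mem hx) hx)) _ (star_mem hu), ← mul_assoc,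
      huu, one_mul]
  simp only [TraceOn.norm2, h]

end Trace

end CD

namespace CD

section Bessel

variable {H : Type} [NormedAddCommGroup H] [InnerProductSpace ℂ H] [CompleteSpace H]
variable {Γ : Type} [Group Γ]

open ContinuousLinearMap Filter Topology
open scoped InnerProductSpace

variable (X : CrossedProduct Γ H)

/-- Fourier coefficient. -/
def coef (x : H →L[ℂ] H) (g : Γ) : H →L[ℂ] H := X.EA.E (x * star (X.u g))

lemma ustar_mem (g : Γ) : star (X.u g) ∈ X.M := star_mem (X.u_mem g)

lemma u_star_mul (g : Γ) : star (X.u g) * X.u g = 1 := by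
  rw [X.u_star, X.u_mul, inv_mul_cancel, X.u_one]

lemma u_mul_star (g : Γ) : X.u g * star (X.u g) = 1 := by
  rw [X.u_star, X.u_mul, mul_inv_cancel, X.u_one]

lemma A_mem_M {a : H →L[ℂ] H} (ha : a ∈ X.A) : a ∈ X.M := X.A_sub ha

lemma EA_mem {x : H →L[ℂ] H} (hx : x ∈ X.M) : X.EA.E x ∈ X.A := X.EA.mem x hx

lemma coef_mem {x : H →L[ℂ] H} (hx : x ∈ X.M) (g : Γ) : coef X x g ∈ X.A :=
  EA_mem X (mul_mem hx (ustar_mem X g))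

lemma coef_memM {x : H →L[ℂ] H} (hx : x ∈ X.M) (g : Γ) : coef X x g ∈ X.M :=
  A_mem_M X (coef_mem X hx g)

lemma EA_left {a x : H →L[ℂ] H} (ha : a ∈ X.A) (hx : x ∈ X.M) :
    X.EA.E (a * x) = a * X.EA.E x := by
  have := X.EA.bimod a ha 1 (one_mem X.A) x hx
  simpa using this

lemma EA_right {a x : H →L[ℂ] H} (ha : a ∈ X.A) (hx : x ∈ X.M) :
    X.EA.E (x * a) = X.EA.E x * a := by
  have := X.EA.bimod 1 (one_mem X.A) a ha x hx
  simpa using this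

lemma tr_EA_left {a x : H →L[ℂ] H} (ha : a ∈ X.A) (hx : x ∈ X.M) :
    X.tr.τ (a * X.EA.E x) = X.tr.τ (a * x) := by
  rw [← EA_left X ha hx, X.EA.trace_eq _ (mul_mem (A_mem_M X ha) hx)]

lemma tr_EA_right {a x : H →L[ℂ] H} (ha : a ∈ X.A) (hx : x ∈ X.M) :
    X.tr.τ (X.EA.E x * a) = X.tr.τ (x * a) := by
  rw [← EA_right X ha hx, X.EA.trace_eq _ (mul_mem hx (A_mem_M X ha))]

lemma EA_unique {w x : H →L[ℂ] H} (hw : w ∈ X.A) (hx : x ∈ X.M)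
    (h : ∀ y ∈ X.A, X.tr.τ (w * y) = X.tr.τ (x * y)) : X.EA.E x = w := by
  have hd : X.EA.E x - w ∈ X.A := sub_mem (EA_mem X hx) hw
  have : X.EA.E x - w = 0 := by
    refine X.tr.faithful _ (A_mem_M X hd) ?_
    rw [X.tr.tracial _ (star_mem (A_mem_M X hd)) _ (A_mem_M X hd), sub_mul, map_sub,
      tr_EA_right X (star_mem hd) hx, h _ (star_mem hd), sub_self]
  exact sub_eq_zero.1 this

lemma sigma_mem {x : H →L[ℂ] H} (hx : x ∈ X.M) (g : Γ) : X.σ g x ∈ X.M :=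
  mul_mem (mul_mem (X.u_mem g) hx) (ustar_mem X g)

lemma sigma_inv_mem {a : H →L[ℂ] H} (ha : a ∈ X.A) (g : Γ) : star (X.u g) * a * X.u g ∈ X.A := by
  have := X.conj_mem g⁻¹ a ha
  rwa [X.u_star, inv_inv, ← X.u_star] at this

lemma EA_sigma {x : H →L[ℂ] H} (hx : x ∈ X.M) (g : Γ) :
    X.EA.E (X.σ g x) = X.σ g (X.EA.E x) := by
  refine EA_unique X (X.conj_mem g _ (EA_mem X hx)) (sigma_mem X hx g) fun y hy => ?_
  have hy' := A_mem_M X hy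
  have key : ∀ z ∈ X.M, X.tr.τ (X.σ g z * y) = X.tr.τ (z * (star (X.u g) * y * X.u g)) := by
    intro z hz
    have e : X.σ g z * y = X.u g * (z * (star (X.u g) * y)) := by
      simp [CrossedProduct.σ, mul_assoc]
    rw [e, X.tr.tracial _ (X.u_mem g) _ (mul_mem hz (mul_mem (ustar_mem X g) hy'))]
    simp [mul_assoc]
  have e2 := tr_EA_right X (sigma_inv_mem X hy g) hx
  rw [key _ hx, ← e2]
  exact key _ (A_mem_M X (EA_mem X hx))

lemma coef_conj {x : H →L[ℂ] H} (hx : x ∈ X.M) (g h : Γ) :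
    coef X (X.σ g x) (g * h * g⁻¹) = X.σ g (coef X x h) := by
  unfold coef
  rw [← EA_sigma X (mul_mem hx (ustar_mem X h))]
  congr 1
  simp only [CrossedProduct.σ, X.u_star, mul_assoc, X.u_mul]
  congr 3
  group

lemma norm2_sigma {x : H →L[ℂ] H} (hx : x ∈ X.M) (g : Γ) :
    X.tr.norm2 (X.σ g x) = X.tr.norm2 x :=
  norm2_conj X.tr (X.u_mem g) hx (u_star_mul X g)

lemma tr_sum_coef {x z : H →L[ℂ] H} (hx : x ∈ X.M) (hz : z ∈ X.M) (S : Finset Γ) :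
    X.tr.τ (star (∑ g ∈ S, coef X x g * X.u g) * z) =
      ∑ g ∈ S, X.tr.τ (star (coef X x g) * coef X z g) := by
  rw [star_sum, Finset.sum_mul, map_sum]
  refine Finset.sum_congr rfl fun g _ => ?_
  have hc := coef_mem X hx g
  rw [star_mul, mul_assoc, X.tr.tracial _ (ustar_mem X g) _
    (mul_mem (A_mem_M X (star_mem hc)) hz), mul_assoc]
  exact (tr_EA_left X (star_mem hc) (mul_mem hz (ustar_mem X g))).symm

lemma coef_partial {x : H →L[ℂ] H} (hx : x ∈ X.M) (S : Finset Γ) {g : Γ} (hg : g ∈ S) :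
    coef X (∑ h ∈ S, coef X x h * X.u h) g = coef X x g := by
  change X.EA.E ((∑ h ∈ S, coef X x h * X.u h) * star (X.u g)) = _
  rw [Finset.sum_mul, map_sum, Finset.sum_eq_single g]
  · rw [mul_assoc, u_mul_star, mul_one]
    exact X.EA.fix _ (coef_mem X hx g)
  · intro h _ hne
    rw [mul_assoc, X.u_star g, X.u_mul, EA_left X (coef_mem X hx h) (X.u_mem _), X.EA_u, mul_zero]
    intro h1
    exact hne (mul_inv_eq_one.1 h1)
  · exact fun h => (h hg).elim

lemma bessel {x : H →L[ℂ] H} (hx : x ∈ X.M) (S : Finset Γ) :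
    ∑ g ∈ S, X.tr.norm2 (coef X x g) ^ 2 ≤ X.tr.norm2 x ^ 2 := by
  set y := ∑ g ∈ S, coef X x g * X.u g with hy
  have hyM : y ∈ X.M := sum_mem fun g _ => mul_mem (coef_memM X hx g) (X.u_mem g)
  set s := ∑ g ∈ S, X.tr.norm2 (coef X x g) ^ 2 with hs
  have h1 : X.tr.τ (star y * x) = (s : ℂ) := by
    rw [hy, tr_sum_coef X hx hx, hs, Complex.ofReal_sum]
    exact Finset.sum_congr rfl fun g _ => (norm2_sq_c X.tr (coef_memM X hx g)).symm
  have h2 : X.tr.τ (star y * y) = (s : ℂ) := by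
    rw [← h1]
    conv_lhs => rw [hy, tr_sum_coef X hx (hy ▸ hyM)]
    conv_rhs => rw [hy, tr_sum_coef X hx hx]
    exact Finset.sum_congr rfl fun g hg => by rw [coef_partial X hx S hg]
  have h3 : X.tr.τ (star x * y) = (s : ℂ) := by
    have := X.tr.star_eq (star y * x) (mul_mem (star_mem hyM) hx)
    rw [h1] at this
    simpa using this
  have h4 := (X.tr.nonneg (x - y) (sub_mem hx hyM)).1
  rw [star_sub, sub_mul, mul_sub, mul_sub, map_sub, map_sub, map_sub, h1, h2, h3] at h4
  rw [norm2_sq X.tr hx]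
  simpa using h4

lemma coef_finite {x : H →L[ℂ] H} (hx : x ∈ X.M) {ε : ℝ} (hε : 0 < ε) :
    {g : Γ | ε ≤ X.tr.norm2 (coef X x g)}.Finite := by
  by_contra hinf
  obtain ⟨n, hn⟩ := exists_nat_gt (X.tr.norm2 x ^ 2 / ε ^ 2)
  obtain ⟨S, hS, hc⟩ := Set.Infinite.exists_subset_card_eq hinf n
  have h1 := bessel X hx S
  have h2 : ∑ g ∈ S, ε ^ 2 ≤ ∑ g ∈ S, X.tr.norm2 (coef X x g) ^ 2 :=
    Finset.sum_le_sum fun g hg => by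
      have : ε ≤ X.tr.norm2 (coef X x g) := hS hg
      gcongr
  rw [Finset.sum_const, hc, nsmul_eq_mul] at h2
  rw [div_lt_iff₀ (by positivity)] at hn
  linarith

lemma exists_small {ι : Type*} [Finite ι] (x : ι → H →L[ℂ] H) (hx : ∀ i, x i ∈ X.M) {ε : ℝ}
    (hε : 0 < ε) {T : Set Γ} (hT : T.Infinite) :
    ∃ g ∈ T, ∀ i, X.tr.norm2 (coef X (x i) g) < ε := by
  have hf : (⋃ i, {g : Γ | ε ≤ X.tr.norm2 (coef X (x i) g)}).Finite :=
    Set.finite_iUnion fun i => coef_finite X (hx i) hε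
  obtain ⟨g, hg, hg2⟩ := (hT.sdiff hf).nonempty
  refine ⟨g, hg, fun i => ?_⟩
  by_contra h
  exact hg2 (Set.mem_iUnion.2 ⟨i, not_lt.1 h⟩)

/-- An element with vanishing non-trivial coefficients is in `A`. -/
lemma eq_EA_of_coef {x : H →L[ℂ] H} (hx : x ∈ X.M) (h : ∀ g : Γ, g ≠ 1 → coef X x g = 0) :
    x = X.EA.E x := by
  have hE := EA_mem X hx
  refine sub_eq_zero.1 (X.fourier_sep _ (sub_mem hx (A_mem_M X hE)) fun g => ?_)
  rw [sub_mul, map_sub]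
  by_cases hg : g = 1
  · subst hg
    rw [X.u_one, star_one, mul_one, mul_one, X.EA.fix _ hE, sub_self]
  · have h1 := h g hg
    unfold coef at h1
    rw [h1, EA_left X hE (ustar_mem X g), X.u_star, X.EA_u _ (inv_ne_one.2 hg)]
    simp

lemma isFactor (hicc : IsICC Γ) (herg : IsErgodic X) :
    IsFactorSet (X.M : Set (H →L[ℂ] H)) := by
  intro x hx hc
  have hσ : ∀ g, X.σ g x = x := by
    intro g
    rw [CrossedProduct.σ, ← hc _ (X.u_mem g), mul_assoc, u_mul_star, mul_one]
  have h1 : ∀ g : Γ, g ≠ 1 → coef X x g = 0 := by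
    intro g hg
    refine norm2_eq_zero X.tr (coef_memM X hx g) ?_
    by_contra hne
    have hpos : 0 < X.tr.norm2 (coef X x g) := lt_of_le_of_ne (norm2_nonneg _ _) (Ne.symm hne)
    obtain ⟨k, ⟨h, rfl⟩, hk⟩ := exists_small X (fun _ : Unit => x) (fun _ => hx) hpos (hicc g hg)
    have h2 := hk ()
    have h3 := coef_conj X hx h g
    rw [hσ] at h3
    rw [h3, norm2_sigma X (coef_memM X hx g)] at h2
    exact lt_irrefl _ h2
  have h2 := eq_EA_of_coef X hx h1
  have h3 : x ∈ X.A := by rw [h2]; exact EA_mem X hx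
  exact herg x h3 hσ

end Bessel

section Factor

variable {H : Type} [NormedAddCommGroup H] [InnerProductSpace ℂ H] [CompleteSpace H]

lemma factor_prime (M : VonNeumannAlgebra H) (hf : IsFactorSet (M : Set (H →L[ℂ] H)))
    {b c : H →L[ℂ] H} (hc : c ∈ M) (h : ∀ z ∈ M, b * z * c = 0) :
    b = 0 ∨ c = 0 := by
  let K₀ : Submodule ℂ H := Submodule.span ℂ {w | ∃ z ∈ M, ∃ v, w = z (c v)}
  let K : Submodule ℂ H := K₀.topologicalClosure
  have : CompleteSpace K := Submodule.topologicalClosure.completeSpace _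
  have hinv : ∀ y : H →L[ℂ] H, (∀ z ∈ M, ∀ v, y (z (c v)) ∈ K₀) → ∀ v ∈ K, y v ∈ K := by
    intro y hy v hv
    have h1 : K₀ ≤ K₀.comap (y : H →ₗ[ℂ] H) := by
      refine Submodule.span_le.2 ?_
      rintro _ ⟨z, hz, w, rfl⟩
      exact hy z hz w
    exact map_mem_closure y.continuous hv fun w hw => h1 hw
  have hin : ∀ z ∈ M, ∀ v, z (c v) ∈ K₀ := fun z hz v => Submodule.subset_span ⟨z, hz, v, rfl⟩
  have hpM : K.starProjection ∈ M := by
    refine vn_proj_mem M K fun y hy => hinv y fun z hz v => ?_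
    have e1 := congrArg (fun T : H →L[ℂ] H => T v) (vn_comm M (mul_mem hz hc) hy)
    have e2 : y (z (c v)) = z (c (y v)) := e1
    rw [e2]; exact hin z hz _
  have hpM' : K.starProjection ∈ M.commutant := by
    refine vn_proj_mem M.commutant K fun y hy => hinv y fun z hz v => ?_
    rw [M.commutant_commutant] at hy
    exact hin (y * z) (mul_mem hy hz) v
  obtain ⟨l, hl⟩ := hf _ hpM fun y hy => vn_comm M hy hpM'
  have hpc : K.starProjection * c = c := by
    ext v
    have : c v ∈ K := Submodule.le_topologicalClosure _ (hin 1 (one_mem M) v)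
    simpa using Submodule.starProjection_eq_self_iff.2 this
  have hbp : b * K.starProjection = 0 := by
    ext v
    have h1 : K₀ ≤ (b : H →ₗ[ℂ] H).ker := by
      refine Submodule.span_le.2 ?_
      rintro _ ⟨z, hz, w, rfl⟩
      exact congrArg (fun T : H →L[ℂ] H => T w) (h z hz)
    have h2 : (K : Set H) ⊆ {w | b w = 0} :=
      closure_minimal (fun w hw => h1 hw) (isClosed_eq b.continuous continuous_const)
    simpa using h2 (Submodule.starProjection_apply_mem K v)
  rw [hl] at hpc hbp
  by_cases hl0 : l = 0
  · right; rw [← hpc, hl0]; simp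
  · left
    have : l • b = 0 := by simpa using hbp
    exact (smul_eq_zero.1 this).resolve_left hl0

end Factor

end CD

namespace CD

section Normal1

variable {H : Type} [NormedAddCommGroup H] [InnerProductSpace ℂ H] [CompleteSpace H]

open ContinuousLinearMap Filter Topology
open scoped InnerProductSpace

variable {M : VonNeumannAlgebra H}

/-- `a ∈ M` such that `z ↦ τ (z a)` is given by a WOT continuous function. -/
def InJ (tr : TraceOn H (M : Set (H →L[ℂ] H))) (a : H →L[ℂ] H) : Prop :=
  a ∈ M ∧ ∃ ψ : (H →WOT[ℂ] H) → ℂ, Continuous ψ ∧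
    ∀ z ∈ M, tr.τ (z * a) = ψ (ContinuousLinearMapWOT.ofCLM z)

variable {tr : TraceOn H (M : Set (H →L[ℂ] H))}

lemma InJ.add {a b : H →L[ℂ] H} (ha : InJ tr a) (hb : InJ tr b) : InJ tr (a + b) := by
  obtain ⟨haM, ψ, hψ, h1⟩ := ha
  obtain ⟨hbM, φ, hφ, h2⟩ := hb
  refine ⟨add_mem haM hbM, fun T => ψ T + φ T, hψ.add hφ, fun z hz => ?_⟩
  rw [mul_add, map_add, h1 z hz, h2 z hz]

lemma InJ.mul_right {a b : H →L[ℂ] H} (ha : InJ tr a) (hb : b ∈ M) : InJ tr (a * b) := by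
  obtain ⟨haM, ψ, hψ, h1⟩ := ha
  refine ⟨mul_mem haM hb, fun T => ψ (ContinuousLinearMapWOT.ofCLM b * T),
    hψ.comp (continuous_const_mul _), fun z hz => ?_⟩
  rw [← mul_assoc, tr.tracial _ (mul_mem hz haM) _ hb, ← mul_assoc, h1 _ (mul_mem hb hz)]
  simp

lemma InJ.mul_left {a b : H →L[ℂ] H} (ha : InJ tr a) (hb : b ∈ M) : InJ tr (b * a) := by
  obtain ⟨haM, ψ, hψ, h1⟩ := ha
  refine ⟨mul_mem hb haM, fun T => ψ (T * ContinuousLinearMapWOT.ofCLM b),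
    hψ.comp (continuous_mul_const _), fun z hz => ?_⟩
  rw [← mul_assoc, h1 _ (mul_mem hz hb)]
  simp

lemma inner_mono {x y : H →L[ℂ] H} (h : x ≤ y) (v : H) :
    (⟪v, x v⟫_ℂ).re ≤ (⟪v, y v⟫_ℂ).re := by
  have h1 := (ContinuousLinearMap.nonneg_iff_isPositive (y - x)).1 (sub_nonneg.2 h)
  have h2 := h1.re_inner_nonneg_right v
  simpa [inner_sub_right] using h2

lemma exists_dominated (tr : TraceOn H (M : Set (H →L[ℂ] H))) {ξ : H} (hξ : ‖ξ‖ = 1) :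
    ∃ h ∈ M, 0 ≤ h ∧ h ≠ 0 ∧ ∀ y ∈ M, 0 ≤ y → y ≤ h → (tr.τ y).re ≤ 2 * (⟪ξ, y ξ⟫_ℂ).re := by
  let S : Set (H →L[ℂ] H) :=
    {x | x ∈ M ∧ 0 ≤ x ∧ x ≤ 1 ∧ 2 * (⟪ξ, x ξ⟫_ℂ).re ≤ (tr.τ x).re}
  have h0S : (0 : H →L[ℂ] H) ∈ S := ⟨zero_mem M, le_rfl, zero_le_one, by simp⟩
  obtain ⟨x, -, hxmax⟩ := zorn_le_nonempty₀ S (by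
    intro c hcS hchain y hy
    let s : ℝ := sSup ((fun j => (tr.τ j).re) '' c)
    have hbdd : BddAbove ((fun j => (tr.τ j).re) '' c) := by
      refine ⟨1, ?_⟩
      rintro _ ⟨j, hj, rfl⟩
      have := tr_mono tr (hcS hj).1 (one_mem M) (hcS hj).2.2.1
      simpa [tr.unital] using this
    let K : c → Set (H →WOT[ℂ] H) := fun i =>
      {T | T.toCLM ∈ M ∧ 0 ≤ T.toCLM ∧ T.toCLM ≤ 1} ∩
        ({T | (i : H →L[ℂ] H) ≤ T.toCLM} ∩ {T | 2 * (⟪ξ, T ξ⟫_ℂ).re ≤ s})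
    have hcl2 : IsClosed {T : H →WOT[ℂ] H | 2 * (⟪ξ, T ξ⟫_ℂ).re ≤ s} :=
      isClosed_le (continuous_const.mul (Complex.continuous_re.comp (wot_continuous_inner _ _)))
        continuous_const
    have hcpt : ∀ i, IsCompact (K i) := fun i =>
      (wot_Icc_compact M).inter_right ((wot_isClosed_le _).inter hcl2)
    have : Nonempty c := ⟨⟨y, hy⟩⟩
    obtain ⟨T, hT⟩ := IsCompact.nonempty_iInter_of_directed_nonempty_isCompact_isClosed K
      (by
        intro i j
        rcases hchain.total i.2 j.2 with hij | hij
        · exact ⟨j, fun T hT => ⟨hT.1, le_trans hij hT.2.1, hT.2.2⟩, fun T hT => hT⟩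
        · exact ⟨i, fun T hT => hT, fun T hT => ⟨hT.1, le_trans hij hT.2.1, hT.2.2⟩⟩)
      (by
        intro i
        have hi := hcS i.2
        refine ⟨ContinuousLinearMapWOT.ofCLM i, ⟨hi.1, hi.2.1, hi.2.2.1⟩,
          le_refl (i : H →L[ℂ] H), ?_⟩
        exact hi.2.2.2.trans (le_csSup hbdd ⟨_, i.2, rfl⟩))
      hcpt (fun i => (hcpt i).isClosed)
    rw [Set.mem_iInter] at hT
    have hT0 := hT ⟨y, hy⟩
    refine ⟨T.toCLM, ⟨hT0.1.1, hT0.1.2.1, hT0.1.2.2, ?_⟩, fun z hz => (hT ⟨z, hz⟩).2.1⟩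
    refine (show 2 * (⟪ξ, T ξ⟫_ℂ).re ≤ s from hT0.2.2).trans ?_
    refine csSup_le ⟨_, y, hy, rfl⟩ ?_
    rintro _ ⟨j, hj, rfl⟩
    exact tr_mono tr (hcS hj).1 hT0.1.1 (hT ⟨j, hj⟩).2.1) 0 h0S
  have hxS : x ∈ S := hxmax.prop
  refine ⟨1 - x, sub_mem (one_mem M) hxS.1, sub_nonneg.2 hxS.2.2.1, ?_, ?_⟩
  · intro h
    have hx1 : x = 1 := (sub_eq_zero.1 h).symm
    have := hxS.2.2.2
    rw [hx1, tr.unital] at this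
    simp only [one_apply_eq_self, inner_self_eq_norm_sq_to_K, hξ] at this
    norm_num at this
  · intro y hy hy0 hyh
    by_contra hlt
    have hS : x + y ∈ S := by
      refine ⟨add_mem hxS.1 hy, add_nonneg hxS.2.1 hy0, ?_, ?_⟩
      · rw [add_comm]; exact le_sub_iff_add_le.1 hyh
      · have := hxS.2.2.2
        simp only [_root_.add_apply, inner_add_right, Complex.add_re, map_add]
        linarith
    have h1 : x + y ≤ x := hxmax.le_of_ge hS (le_add_of_nonneg_right hy0)
    have h2 : y ≤ 0 := by simpa using h1
    have h3 : y = 0 := le_antisymm h2 hy0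
    rw [h3] at hlt
    simp at hlt

lemma exists_inJ (tr : TraceOn H (M : Set (H →L[ℂ] H))) :
    ∃ a, InJ tr a ∧ 0 ≤ a ∧ a ≠ 0 := by
  have hnt : ∃ v : H, v ≠ 0 := by
    by_contra hcon
    push Not at hcon
    have h1 : (1 : H →L[ℂ] H) = 0 := by
      ext v; rw [hcon v]; simp
    have := tr.unital
    rw [h1] at this
    simp at this
  obtain ⟨v, hv⟩ := hnt
  obtain ⟨ξ, hξ⟩ : ∃ ξ : H, ‖ξ‖ = 1 := ⟨((‖v‖ : ℂ)⁻¹) • v, by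
    rw [norm_smul]; simp [hv]⟩
  obtain ⟨h, hM, h0, hne, hdom⟩ := exists_dominated tr hξ
  obtain ⟨a, haM, ha0, hasa, haa⟩ := vn_sqrt M hM h0
  refine ⟨a, ⟨haM, ?_⟩, ha0, ?_⟩
  swap
  · rintro rfl
    exact hne (by rw [← haa]; simp)
  have key : ∀ z ∈ M, ‖tr.τ (z * a)‖ ≤ 2 * ‖z (a ξ)‖ := by
    intro z hz
    have hzaM := mul_mem hz haM
    have h1 : ‖tr.τ (z * a)‖ ≤ tr.norm2 (z * a) := by
      have := tr_cs tr (one_mem M) hzaM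
      have e : tr.norm2 1 = 1 := by simp [TraceOn.norm2, tr.unital]
      simpa [e] using this
    have h2 : tr.norm2 (z * a) ^ 2 ≤ 2 * ‖z (a ξ)‖ ^ 2 := by
      rw [norm2_sq tr hzaM]
      by_cases hz0 : z = 0
      · subst hz0; simp
      have hzn : 0 < ‖z‖ := norm_pos_iff.2 hz0
      let y : H →L[ℂ] H := ((‖z‖ ^ 2)⁻¹ : ℝ) • (star (z * a) * (z * a))
      have hyM : y ∈ M := vn_rsmul_mem M _ (mul_mem (star_mem hzaM) hzaM)
      have hy0 : 0 ≤ y := smul_nonneg (by positivity) (star_mul_self_nonneg _)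
      have hyh : y ≤ h := by
        have e1 : star z * z ≤ algebraMap ℝ (H →L[ℂ] H) (‖z‖ ^ 2) :=
          CStarAlgebra.star_mul_le_algebraMap_norm_sq
        have e2 := star_left_conjugate_le_conjugate e1 a
        have e3 : star a * (star z * z) * a = star (z * a) * (z * a) := by simp [mul_assoc]
        rw [e3, Algebra.algebraMap_eq_smul_one, mul_smul_comm, mul_one, smul_mul_assoc, hasa,
          haa] at e2
        have e4 := smul_le_smul_of_nonneg_left e2 (show (0 : ℝ) ≤ (‖z‖ ^ 2)⁻¹ by positivity)
        rwa [smul_smul, inv_mul_cancel₀ (by positivity), one_smul] at e4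
      have hd := hdom y hyM hy0 hyh
      have e5 : (⟪ξ, y ξ⟫_ℂ).re = (‖z‖ ^ 2)⁻¹ * ‖z (a ξ)‖ ^ 2 := by
        have e6 : ⟪ξ, (star (z * a) * (z * a)) ξ⟫_ℂ = ((‖z (a ξ)‖ ^ 2 : ℝ) : ℂ) := by
          rw [mul_apply_eq_comp, ContinuousLinearMap.star_eq_adjoint,
            ContinuousLinearMap.adjoint_inner_right, inner_self_eq_norm_sq_to_K]
          simp
        have e7 : y ξ = (((‖z‖ ^ 2)⁻¹ : ℝ) : ℂ) • ((star (z * a) * (z * a)) ξ) := by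
          exact (Complex.coe_smul _ _).symm
        rw [e7, inner_smul_right, e6, ← Complex.ofReal_mul, Complex.ofReal_re]
      rw [e5, show tr.τ y = _ from tr_rsmul tr _ _, Complex.re_ofReal_mul] at hd
      have hd2 : (‖z‖ ^ 2)⁻¹ * (tr.τ (star (z * a) * (z * a))).re ≤
          (‖z‖ ^ 2)⁻¹ * (2 * ‖z (a ξ)‖ ^ 2) := by linarith
      exact le_of_mul_le_mul_left hd2 (by positivity)
    have h3 := norm2_nonneg tr (z * a)
    have h4 := norm_nonneg (z (a ξ))
    have h5 : tr.norm2 (z * a) ≤ 2 * ‖z (a ξ)‖ :=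
      le_of_sq_le_sq (by nlinarith) (by positivity)
    exact h1.trans h5
  let L : M.toStarSubalgebra →ₗ[ℂ] H :=
    { toFun := fun z => (z : H →L[ℂ] H) (a ξ)
      map_add' := fun z w => by simp
      map_smul' := fun c z => by simp }
  let f : M.toStarSubalgebra →ₗ[ℂ] ℂ :=
    { toFun := fun z => tr.τ ((z : H →L[ℂ] H) * a)
      map_add' := fun z w => by simp [add_mul]
      map_smul' := fun c z => by simp }
  have hLf : ∀ z, ‖f z‖ ≤ 2 * ‖L z‖ := fun z => key z z.2
  have hker : L.ker ≤ f.ker := by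
    intro z hz
    have h1 := hLf z
    rw [LinearMap.mem_ker] at hz ⊢
    rw [hz] at h1
    simpa using h1
  let g : L.range →ₗ[ℂ] ℂ := (L.ker.liftQ f hker) ∘ₗ (L.quotKerEquivRange.symm : _ →ₗ[ℂ] _)
  have hg : ∀ z, g ⟨L z, LinearMap.mem_range_self L z⟩ = f z := by
    intro z
    have : L.quotKerEquivRange.symm ⟨L z, LinearMap.mem_range_self L z⟩ =
        Submodule.Quotient.mk z := by
      rw [LinearEquiv.symm_apply_eq]
      rfl
    change (L.ker.liftQ f hker) (L.quotKerEquivRange.symm ⟨L z, LinearMap.mem_range_self L z⟩) = _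
    rw [this]
    rfl
  let G : L.range →L[ℂ] ℂ := g.mkContinuous 2 (by
    rintro ⟨_, z, rfl⟩
    rw [hg]
    exact hLf z)
  obtain ⟨φ, hφ, -⟩ := exists_extension_norm_eq L.range G
  refine ⟨fun T => φ (T (a ξ)), ContinuousLinearMapWOT.continuous_dual_apply _ _, ?_⟩
  intro z hz
  have h1 := hφ ⟨L ⟨z, hz⟩, LinearMap.mem_range_self L _⟩
  have h2 := hg ⟨z, hz⟩
  exact (h1.trans h2).symm

lemma quad_nonneg {T : H →L[ℂ] H} (hsa : star T = T) (h : ∀ v, 0 ≤ (⟪v, T v⟫_ℂ).re) : 0 ≤ T := by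
  rw [ContinuousLinearMap.nonneg_iff_isPositive, ContinuousLinearMap.isPositive_def]
  refine ⟨?_, fun v => ?_⟩
  · exact (ContinuousLinearMap.isSelfAdjoint_iff_isSymmetric).1 hsa
  · rw [ContinuousLinearMap.reApplyInnerSelf_apply, inner_re_symm]
    exact h v

lemma exists_proj_inJ (tr : TraceOn H (M : Set (H →L[ℂ] H))) :
    ∃ p, InJ tr p ∧ star p = p ∧ p * p = p ∧ p ≠ 0 := by
  obtain ⟨a, haJ, ha0, hane⟩ := exists_inJ tr
  have haM := haJ.1
  have hsa : IsSelfAdjoint a := IsSelfAdjoint.of_nonneg ha0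
  have hna : 0 < ‖a‖ := norm_pos_iff.2 hane
  set δ : ℝ := ‖a‖ / 2 with hδ
  have hδ0 : 0 < δ := by positivity
  let c : H →L[ℂ] H := cfc (fun t : ℝ => max (t - δ) 0) a
  have hcM : c ∈ M := vn_cfc_mem M _ haM
  have hcsa : star c = c := (cfc_predicate _ a : IsSelfAdjoint _)
  have haδ : a - algebraMap ℝ (H →L[ℂ] H) δ = cfc (fun t : ℝ => t - δ) a := by
    rw [cfc_sub (fun t : ℝ => t) (fun _ => δ) a, cfc_id' ℝ a, cfc_const δ a]
  have hcne : c ≠ 0 := by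
    intro hc
    have h1 : a - algebraMap ℝ (H →L[ℂ] H) δ ≤ c := by
      rw [haδ]
      exact cfc_mono fun t _ => le_max_left _ _
    rw [hc, sub_nonpos] at h1
    have h2 := (CStarAlgebra.norm_le_iff_le_algebraMap a hδ0.le).2 h1
    rw [hδ] at h2
    linarith
  have hcac : 0 ≤ c * (a - algebraMap ℝ (H →L[ℂ] H) δ) * c := by
    rw [haδ, ← cfc_mul _ _ a, ← cfc_mul _ _ a]
    refine cfc_nonneg fun t _ => ?_
    rcases le_total (t - δ) 0 with h | h
    · simp [max_eq_right h]
    · rw [max_eq_left h]; positivity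
  obtain ⟨e, heM, hesa, hee, hec, -, hecl⟩ := vn_rangeProj M hcM
  have hq : ∀ v, 0 ≤ (⟪e v, (a - algebraMap ℝ (H →L[ℂ] H) δ) (e v)⟫_ℂ).re := by
    intro v
    have hcl : IsClosed {w : H | 0 ≤ (⟪w, (a - algebraMap ℝ (H →L[ℂ] H) δ) w⟫_ℂ).re} := by
      refine isClosed_le continuous_const (Complex.continuous_re.comp ?_)
      exact continuous_id.inner (ContinuousLinearMap.continuous _)
    refine closure_minimal ?_ hcl (hecl v)
    rintro _ ⟨w, rfl⟩
    have h1 := ((ContinuousLinearMap.nonneg_iff_isPositive _).1 hcac).re_inner_nonneg_right w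
    have h2 : ⟪w, (c * (a - algebraMap ℝ (H →L[ℂ] H) δ) * c) w⟫_ℂ =
        ⟪c w, (a - algebraMap ℝ (H →L[ℂ] H) δ) (c w)⟫_ℂ := by
      rw [← ContinuousLinearMap.adjoint_inner_right, ← ContinuousLinearMap.star_eq_adjoint, hcsa]
      rfl
    rw [h2] at h1
    exact h1
  have hE : 0 ≤ e * (a - algebraMap ℝ (H →L[ℂ] H) δ) * e := by
    refine quad_nonneg ?_ fun v => ?_
    · simp only [star_mul, star_sub, hesa, hsa.star_eq, mul_assoc]
      rw [(IsSelfAdjoint.algebraMap (H →L[ℂ] H) (IsSelfAdjoint.all δ)).star_eq]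
    · have h2 : ⟪v, (e * (a - algebraMap ℝ (H →L[ℂ] H) δ) * e) v⟫_ℂ =
          ⟪e v, (a - algebraMap ℝ (H →L[ℂ] H) δ) (e v)⟫_ℂ := by
        rw [← ContinuousLinearMap.adjoint_inner_right, ← ContinuousLinearMap.star_eq_adjoint, hesa]
        rfl
      rw [h2]; exact hq v
  let T : H →L[ℂ] H := e * a * e + (1 - e)
  have hTM : T ∈ M := add_mem (mul_mem (mul_mem heM haM) heM) (sub_mem (one_mem M) heM)
  have he0 : 0 ≤ e := by rw [← hee]; nth_rewrite 1 [← hesa]; exact star_mul_self_nonneg e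
  have h1e : 0 ≤ 1 - e := by
    have : (1 - e) = star (1 - e) * (1 - e) := by
      simp [hesa, mul_sub, sub_mul, hee]
    rw [this]; exact star_mul_self_nonneg _
  set m : ℝ := min δ 1 with hm
  have hm0 : 0 < m := lt_min hδ0 one_pos
  have hTm : m • (1 : H →L[ℂ] H) ≤ T := by
    have e1 : T - m • (1 : H →L[ℂ] H) = e * (a - algebraMap ℝ (H →L[ℂ] H) δ) * e +
        ((δ - m) • e + (1 - m) • (1 - e)) := by
      simp only [T, Algebra.algebraMap_eq_smul_one, mul_sub, sub_mul, mul_smul_comm,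
        smul_mul_assoc, mul_one, hee]
      module
    rw [← sub_nonneg, e1]
    refine add_nonneg hE (add_nonneg ?_ ?_)
    · exact smul_nonneg (sub_nonneg.2 (min_le_left _ _)) he0
    · exact smul_nonneg (sub_nonneg.2 (min_le_right _ _)) h1e
  have hTu : IsUnit T := by
    refine CStarAlgebra.isUnit_of_le (m • (1 : H →L[ℂ] H)) hTm ?_
    rw [IsStrictlyPositive.iff_of_unital]
    refine ⟨smul_nonneg hm0.le zero_le_one, ?_⟩
    rw [← Algebra.algebraMap_eq_smul_one]
    exact (IsUnit.mk0 m hm0.ne').map _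
  obtain ⟨U, hU⟩ := hTu
  have hUinv : (↑U⁻¹ : H →L[ℂ] H) ∈ M := by
    refine vn_mem_of_comm M fun y hy => ?_
    have h1 : Commute y (U : H →L[ℂ] H) := by
      rw [hU]; exact vn_comm M hTM hy
    exact h1.units_inv_right.eq
  have heT : e * T = e * a * e := by
    simp only [T, mul_add, mul_sub, mul_one, ← mul_assoc, hee]
    simp
  have heq : e * a * e * ↑U⁻¹ = e := by
    rw [← heT, ← hU, mul_assoc, Units.mul_inv, mul_one]
  refine ⟨e, ?_, hesa, hee, ?_⟩
  · rw [← heq]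
    exact ((haJ.mul_left heM).mul_right heM).mul_right hUinv
  · rintro rfl
    exact hcne (by rw [← hec]; simp)

end Normal1

end CD

namespace CD

section Normal2

variable {H : Type} [NormedAddCommGroup H] [InnerProductSpace ℂ H] [CompleteSpace H]

open ContinuousLinearMap Filter Topology
open scoped InnerProductSpace

variable {M : VonNeumannAlgebra H}

lemma norm_le_one_iff_star {w : H →L[ℂ] H} : ‖w‖ ≤ 1 ↔ star w * w ≤ 1 := by
  rw [← CStarAlgebra.norm_le_one_iff_of_nonneg (star w * w) (star_mul_self_nonneg w),
    CStarRing.norm_star_mul_self]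
  constructor
  · intro h; nlinarith [norm_nonneg w]
  · intro h; nlinarith [norm_nonneg w]

lemma proj_nonneg {e : H →L[ℂ] H} (hesa : star e = e) (hee : e * e = e) : 0 ≤ e := by
  have : e = star e * e := by rw [hesa, hee]
  rw [this]; exact star_mul_self_nonneg e

lemma proj_le_one {e : H →L[ℂ] H} (hesa : star e = e) (hee : e * e = e) : e ≤ 1 := by
  have : 0 ≤ 1 - e := proj_nonneg (by simp [hesa]) (by simp [mul_sub, sub_mul, hee])
  exact sub_nonneg.1 this

/-- extreme points are partial isometries with the maximality property. -/
lemma exists_extreme (M : VonNeumannAlgebra H) {p : H →L[ℂ] H} :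
    ∃ x ∈ M, p * x * (1 - p) = x ∧ ‖x‖ ≤ 1 ∧ ∀ y ∈ M, p * y * (1 - p) = y → ‖x + y‖ ≤ 1 →
      ‖x - y‖ ≤ 1 → y = 0 := by
  let B : Set (H →WOT[ℂ] H) := {T | ‖T.toCLM‖ ≤ 1} ∩ ({T | T.toCLM ∈ M} ∩
    {T | ContinuousLinearMapWOT.ofCLM p * T * ContinuousLinearMapWOT.ofCLM (1 - p) = T})
  have hB : IsCompact B := by
    refine wot_ball_compact.inter_right ((wot_isClosed_vn M).inter ?_)
    exact isClosed_eq ((continuous_mul_const _).comp (continuous_const_mul _)) continuous_id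
  have hne : B.Nonempty := ⟨0, by simp, by simp, by simp⟩
  obtain ⟨T, hT⟩ := hB.extremePoints_nonempty hne
  rw [mem_extremePoints] at hT
  obtain ⟨⟨hT1, hTM, hTp⟩, hext⟩ := hT
  refine ⟨T.toCLM, hTM, congrArg ContinuousLinearMapWOT.toCLM hTp, hT1, ?_⟩
  intro y hy hyp h1 h2
  have hyp' : ContinuousLinearMapWOT.ofCLM p * ContinuousLinearMapWOT.ofCLM y *
      ContinuousLinearMapWOT.ofCLM (1 - p) = ContinuousLinearMapWOT.ofCLM y :=
    congrArg ContinuousLinearMapWOT.ofCLM hyp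
  have hTp' : ContinuousLinearMapWOT.ofCLM p * T * ContinuousLinearMapWOT.ofCLM (1 - p) = T := hTp
  have m1 : T + ContinuousLinearMapWOT.ofCLM y ∈ B :=
    ⟨h1, add_mem (s := M) hTM hy, by
      change ContinuousLinearMapWOT.ofCLM p * (T + ContinuousLinearMapWOT.ofCLM y) *
        ContinuousLinearMapWOT.ofCLM (1 - p) = _
      rw [mul_add, add_mul, hyp', hTp']⟩
  have m2 : T - ContinuousLinearMapWOT.ofCLM y ∈ B :=
    ⟨h2, sub_mem (S := VonNeumannAlgebra H) hTM hy, by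
      change ContinuousLinearMapWOT.ofCLM p * (T - ContinuousLinearMapWOT.ofCLM y) *
        ContinuousLinearMapWOT.ofCLM (1 - p) = _
      rw [mul_sub, sub_mul, hyp', hTp']⟩
  have := (hext _ m1 _ m2 ⟨1 / 2, 1 / 2, by norm_num, by norm_num, by norm_num, by module⟩).1
  have h3 : ContinuousLinearMapWOT.ofCLM y = 0 := by simpa using this
  exact congrArg ContinuousLinearMapWOT.toCLM h3

lemma exists_partial (M : VonNeumannAlgebra H) (hf : IsFactorSet (M : Set (H →L[ℂ] H)))
    {p : H →L[ℂ] H} (hpM : p ∈ M) (hpsa : star p = p) (hpp : p * p = p) :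
    ∃ x ∈ M, p * x = x ∧ x * (1 - p) = x ∧ x * star x * x = x ∧
      (x * star x = p ∨ star x * x = 1 - p) := by
  obtain ⟨x, hxM, hpx, hx1, hext⟩ := exists_extreme M (p := p)
  set r : H →L[ℂ] H := 1 - p with hr
  have hrM : r ∈ M := sub_mem (one_mem M) hpM
  have hrsa : star r = r := by simp [hr, hpsa]
  have hrr : r * r = r := by simp [hr, mul_sub, sub_mul, hpp]
  have hpr : p * r = 0 := by simp [hr, mul_sub, hpp]
  have hrp : r * p = 0 := by simp [hr, sub_mul, hpp]
  have h1 : p * x = x := by rw [← hpx, ← mul_assoc, ← mul_assoc, hpp]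
  have h2 : x * r = x := by rw [← hpx, mul_assoc _ r r, hrr]
  have h1s : star x * p = star x := by
    have := congrArg star h1
    rwa [star_mul, hpsa] at this
  have h2s : r * star x = star x := by
    have := congrArg star h2
    rwa [star_mul, hrsa] at this
  have hxsM : star x ∈ M := star_mem hxM
  have hxx : x * star x * x = x := by
    set t := star x * x with ht
    set s : H →L[ℂ] H := 1 - t with hs
    have ht1 : t ≤ 1 := norm_le_one_iff_star.1 hx1
    have ht0 : 0 ≤ t := star_mul_self_nonneg x
    have hs0 : 0 ≤ s := sub_nonneg.2 ht1
    have hs1 : s ≤ 1 := sub_le_self 1 ht0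
    have hssa : star s = s := by simp [hs, ht]
    have htM : t ∈ M := mul_mem hxsM hxM
    have hsM : s ∈ M := sub_mem (one_mem M) htM
    have hy : x * ((1 / 2 : ℝ) • s) = 0 := by
      refine hext _ (mul_mem hxM (vn_rsmul_mem M _ hsM)) ?_ ?_ ?_
      · have e1 : x * s * r = x * s := by
          have : t * r = t := by rw [ht, mul_assoc, h2]
          have hh : x * s = x - x * t := by rw [hs, mul_sub x 1 t, mul_one]
          rw [hh, sub_mul x (x * t) r, h2, mul_assoc, this]
        rw [mul_smul_comm, mul_smul_comm, smul_mul_assoc, ← mul_assoc, h1, e1]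
      · rw [norm_le_one_iff_star]
        have e1 : star (x + x * ((1 / 2 : ℝ) • s)) * (x + x * ((1 / 2 : ℝ) • s)) =
            t + (1 / 2 : ℝ) • (t * s + s * t) + (1 / 4 : ℝ) • (s * t * s) := by
          simp only [star_add, star_mul, star_smul, hssa, add_mul, mul_add, smul_mul_assoc,
            mul_smul_comm, star_trivial, ht, mul_assoc, smul_add, smul_smul]
          norm_num
          abel
        have e2 : 1 - (t + (1 / 2 : ℝ) • (t * s + s * t) + (1 / 4 : ℝ) • (s * t * s)) =
            (3 / 4 : ℝ) • (star s * s) + (1 / 4 : ℝ) • (star s * s * s) := by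
          have : t = 1 - s := by simp [hs]
          rw [this, hssa]
          simp only [sub_mul, mul_sub, one_mul, mul_one]
          module
        rw [e1, ← sub_nonneg, e2]
        refine add_nonneg (smul_nonneg (by norm_num) (star_mul_self_nonneg s))
          (smul_nonneg (by norm_num) ?_)
        have := star_left_conjugate_nonneg hs0 s
        simpa [hssa, mul_assoc] using this
      · have e1 : x - x * ((1 / 2 : ℝ) • s) = x * (1 - (1 / 2 : ℝ) • s) := by
          rw [mul_sub, mul_one]
        rw [e1]
        refine (norm_mul_le _ _).trans ?_
        have e2 : ‖1 - (1 / 2 : ℝ) • s‖ ≤ 1 := by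
          refine norm_le_one_of_Icc ?_ ?_
          · have : 1 - (1 / 2 : ℝ) • s = (1 / 2 : ℝ) • (1 - s) + (1 / 2 : ℝ) • 1 := by module
            rw [this]
            exact add_nonneg (smul_nonneg (by norm_num) (sub_nonneg.2 hs1))
              (smul_nonneg (by norm_num) zero_le_one)
          · exact sub_le_self 1 (smul_nonneg (by norm_num) hs0)
        exact mul_le_one₀ hx1 (norm_nonneg _) e2
    have hxs : x * s = 0 := by
      rw [mul_smul_comm] at hy
      exact (smul_eq_zero.1 hy).resolve_left (by norm_num)
    rw [hs, mul_sub, mul_one, sub_eq_zero, ht, ← mul_assoc] at hxs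
    exact hxs.symm
  refine ⟨x, hxM, h1, h2, hxx, ?_⟩
  have hxx' : star x * x * star x = star x := by
    have := congrArg star hxx
    simpa [mul_assoc] using this
  set f := x * star x with hfdef
  set q := star x * x with hq
  have hfM : f ∈ M := mul_mem hxM hxsM
  have hqM : q ∈ M := mul_mem hxsM hxM
  have hfsa : star f = f := by simp [hfdef]
  have hqsa : star q = q := by simp [hq]
  have hff : f * f = f := by
    rw [hfdef, ← mul_assoc, hxx]
  have hqq : q * q = q := by
    rw [hq, ← mul_assoc, hxx']
  have hpf : p * f = f := by rw [hfdef, ← mul_assoc, h1]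
  have hfp : f * p = f := by rw [hfdef, mul_assoc, h1s]
  have hqr : q * r = q := by rw [hq, mul_assoc, h2]
  have hrq : r * q = q := by rw [hq, ← mul_assoc, h2s]
  have hPsa : star (p - f) = p - f := by rw [star_sub, hpsa, hfsa]
  have hPP : (p - f) * (p - f) = p - f := by
    simp [mul_sub, sub_mul, hpp, hff, hpf, hfp]
  have hQsa : star (r - q) = r - q := by rw [star_sub, hrsa, hqsa]
  have hQQ : (r - q) * (r - q) = r - q := by
    simp [mul_sub, sub_mul, hrr, hqq, hrq, hqr]
  have hxP : star x * (p - f) = 0 := by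
    rw [mul_sub, h1s, hfdef, ← mul_assoc, ← hq, hq, hxx', sub_self]
  have hPx : (p - f) * x = 0 := by
    rw [sub_mul, h1, hfdef, hxx, sub_self]
  have hsmall : ∀ z ∈ M, ‖z‖ ≤ 1 → (p - f) * z * (r - q) = 0 := by
    intro z hz hz1
    set y := (p - f) * z * (r - q) with hy
    have hyM : y ∈ M := mul_mem (mul_mem (sub_mem hpM hfM) hz) (sub_mem hrM hqM)
    have hxy : star x * y = 0 := by rw [hy, ← mul_assoc, ← mul_assoc, hxP]; simp
    have hyx : star y * x = 0 := by
      have := congrArg star hxy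
      simpa using this
    have hyy : star y * y ≤ r - q := by
      have e1 : ‖(p - f) * z‖ ≤ 1 := (norm_mul_le _ _).trans
        (mul_le_one₀ (norm_le_one_of_Icc (proj_nonneg hPsa hPP) (proj_le_one hPsa hPP))
          (norm_nonneg _) hz1)
      have e2 := star_left_conjugate_le_conjugate (norm_le_one_iff_star.1 e1) (r - q)
      rw [mul_one, hQsa, hQQ] at e2
      have e3 : star y * y = (r - q) * (star ((p - f) * z) * ((p - f) * z)) * (r - q) := by
        rw [hy, star_mul, hQsa]
        simp only [mul_assoc]
      rw [e3]; exact e2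
    have hle : q + star y * y ≤ 1 := by
      calc q + star y * y ≤ q + (r - q) := by gcongr
        _ = r := by abel
        _ ≤ 1 := proj_le_one hrsa hrr
    refine hext y hyM ?_ ?_ ?_
    · have e1 : p * (p - f) = p - f := by rw [mul_sub, hpp, hpf]
      have e2 : (r - q) * r = r - q := by rw [sub_mul, hrr, hqr]
      rw [hy, ← mul_assoc, ← mul_assoc, e1, mul_assoc _ (r - q) r, e2]
    · rw [norm_le_one_iff_star]
      have : star (x + y) * (x + y) = q + star y * y := by
        rw [star_add, add_mul, mul_add, mul_add, hxy, hyx, add_zero, zero_add]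
      rw [this]; exact hle
    · rw [norm_le_one_iff_star]
      have : star (x - y) * (x - y) = q + star y * y := by
        rw [star_sub, sub_mul, mul_sub, mul_sub, hxy, hyx, sub_zero, zero_sub, sub_neg_eq_add]
      rw [this]; exact hle
  have hall : ∀ z ∈ M, (p - f) * z * (r - q) = 0 := by
    intro z hz
    by_cases hz0 : z = 0
    · simp [hz0]
    have hzn : 0 < ‖z‖ := norm_pos_iff.2 hz0
    have := hsmall (‖z‖⁻¹ • z) (vn_rsmul_mem M _ hz) (by
      rw [norm_smul, norm_inv, norm_norm, inv_mul_cancel₀ hzn.ne'])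
    rw [mul_smul_comm, smul_mul_assoc] at this
    exact (smul_eq_zero.1 this).resolve_left (inv_ne_zero hzn.ne')
  rcases factor_prime M hf (sub_mem hrM hqM) hall with h | h
  · left; exact (sub_eq_zero.1 h).symm
  · right; exact (sub_eq_zero.1 h).symm

lemma doubling (tr : TraceOn H (M : Set (H →L[ℂ] H))) (hf : IsFactorSet (M : Set (H →L[ℂ] H)))
    {p : H →L[ℂ] H} (hpJ : InJ tr p) (hpsa : star p = p) (hpp : p * p = p) :
    InJ tr 1 ∨ ∃ q, InJ tr q ∧ star q = q ∧ q * q = q ∧ (tr.τ q).re = 2 * (tr.τ p).re := by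
  obtain ⟨x, hxM, h1, h2, hxx, hor⟩ := exists_partial M hf hpJ.1 hpsa hpp
  have hxsM : star x ∈ M := star_mem hxM
  have hqJ : InJ tr (star x * x) := by
    have := (hpJ.mul_left hxsM).mul_right hxM
    rwa [mul_assoc, h1] at this
  rcases hor with h | h
  · right
    have hpx : x * p = 0 := by
      rw [← h2, mul_assoc, sub_mul, one_mul, hpp, sub_self, mul_zero]
    have hpx' : p * star x = 0 := by
      have := congrArg star hpx
      simpa [hpsa] using this
    refine ⟨p + star x * x, hpJ.add hqJ, by simp [hpsa], ?_, ?_⟩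
    · rw [add_mul, mul_add, mul_add, hpp, ← mul_assoc p, hpx', mul_assoc _ x p, hpx,
        mul_assoc (star x) x, ← mul_assoc x (star x) x, hxx]
      simp
    · rw [map_add, tr.tracial _ hxsM _ hxM, h, Complex.add_re]; ring
  · left
    have := hpJ.add hqJ
    rw [h] at this
    simpa using this

theorem normal_of_factor (tr : TraceOn H (M : Set (H →L[ℂ] H)))
    (hf : IsFactorSet (M : Set (H →L[ℂ] H))) : InJ tr 1 := by
  by_contra hcon
  obtain ⟨p, hpJ, hpsa, hpp, hp0⟩ := exists_proj_inJ tr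
  have hpos : 0 < (tr.τ p).re := by
    by_contra h
    exact hp0 (tr_pos_eq_zero tr hpJ.1 (proj_nonneg hpsa hpp) (not_lt.1 h))
  have hn : ∀ n : ℕ, ∃ q, InJ tr q ∧ star q = q ∧ q * q = q ∧
      (tr.τ q).re = 2 ^ n * (tr.τ p).re := by
    intro n
    induction n with
    | zero => exact ⟨p, hpJ, hpsa, hpp, by simp⟩
    | succ n ih =>
      obtain ⟨q, hq, hq1, hq2, hq3⟩ := ih
      rcases doubling tr hf hq hq1 hq2 with h | ⟨q', a, b, c, d⟩
      · exact (hcon h).elim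
      · exact ⟨q', a, b, c, by rw [d, hq3]; ring⟩
  obtain ⟨n, hn2⟩ := pow_unbounded_of_one_lt (1 / (tr.τ p).re) (one_lt_two)
  obtain ⟨q, hq, hq1, hq2, hq3⟩ := hn n
  have h1 := tr_mono tr hq.1 (one_mem M) (proj_le_one hq1 hq2)
  rw [tr.unital, hq3] at h1
  rw [div_lt_iff₀ hpos] at hn2
  simp at h1
  linarith

end Normal2

end CD

namespace CD

section CondExp

variable {H : Type} [NormedAddCommGroup H] [InnerProductSpace ℂ H] [CompleteSpace H]

open ContinuousLinearMap Filter Topology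
open scoped InnerProductSpace

variable {M : VonNeumannAlgebra H}

lemma tr_mul_nonneg (tr : TraceOn H (M : Set (H →L[ℂ] H))) {a b : H →L[ℂ] H} (ha : a ∈ M)
    (hb : b ∈ M) (ha0 : 0 ≤ a) (hb0 : 0 ≤ b) : 0 ≤ (tr.τ (a * b)).re := by
  obtain ⟨s, hs, _, hssa, rfl⟩ := vn_sqrt M hb hb0
  rw [← mul_assoc, tr.tracial _ (mul_mem ha hs) _ hs, ← mul_assoc]
  refine tr_nonneg tr (mul_mem (mul_mem hs ha) hs) ?_
  have := star_left_conjugate_nonneg ha0 s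
  rwa [hssa] at this

/-- For self-adjoint `y ∈ N` there is a projection in `N` maximizing `τ (x y)`. -/
lemma exists_maximizer (tr : TraceOn H (M : Set (H →L[ℂ] H))) (N : VonNeumannAlgebra H)
    (hNM : ∀ x ∈ N, x ∈ M) {x y : H →L[ℂ] H} (hx : x ∈ M) (hx0 : 0 ≤ x) (hx1 : x ≤ 1)
    (hy : y ∈ N) (hysa : star y = y) :
    ∃ e ∈ N, 0 ≤ e ∧ e ≤ 1 ∧ (tr.τ (x * y)).re ≤ (tr.τ (e * y)).re := by
  have hsa : IsSelfAdjoint y := hysa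
  let yp : H →L[ℂ] H := cfc (fun t : ℝ => max t 0) y
  let ym : H →L[ℂ] H := cfc (fun t : ℝ => max (-t) 0) y
  have hypN : yp ∈ N := vn_cfc_mem N _ hy
  have hymN : ym ∈ N := vn_cfc_mem N _ hy
  have hyp0 : 0 ≤ yp := cfc_nonneg fun t _ => le_max_right _ _
  have hym0 : 0 ≤ ym := cfc_nonneg fun t _ => le_max_right _ _
  have hyd : y = yp - ym := by
    rw [← cfc_sub _ _ y]
    conv_lhs => rw [← cfc_id' ℝ y]
    refine cfc_congr fun t _ => ?_
    rcases le_total t 0 with h | h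
    · simp [h]
    · simp [h]
  have hmp : ym * yp = 0 := by
    rw [← cfc_mul _ _ y]
    have : cfc (fun _ : ℝ => (0 : ℝ)) y = 0 := by simp
    rw [← this]
    refine cfc_congr fun t _ => ?_
    rcases le_total t 0 with h | h
    · simp [h]
    · simp [h]
  obtain ⟨e, heN, hesa, hee, hey, hkill, -⟩ := vn_rangeProj N hypN
  have hme : ym * e = 0 := hkill ym hmp
  refine ⟨e, heN, proj_nonneg hesa hee, proj_le_one hesa hee, ?_⟩
  have h1 : tr.τ (e * y) = tr.τ yp := by
    rw [hyd, mul_sub, map_sub, hey, tr.tracial _ (hNM _ heN) _ (hNM _ hymN), hme]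
    simp
  have h2 : 0 ≤ (tr.τ ((1 - x) * yp)).re :=
    tr_mul_nonneg tr (sub_mem (one_mem M) hx) (hNM _ hypN) (sub_nonneg.2 hx1) hyp0
  have h3 : 0 ≤ (tr.τ (x * ym)).re := tr_mul_nonneg tr hx (hNM _ hymN) hx0 hym0
  rw [h1]
  rw [sub_mul, one_mul, map_sub, Complex.sub_re] at h2
  rw [hyd, mul_sub, map_sub, Complex.sub_re]
  linarith

lemma cexp_Icc (tr : TraceOn H (M : Set (H →L[ℂ] H))) (hnor : InJ tr 1) (N : VonNeumannAlgebra H)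
    (hNM : ∀ x ∈ N, x ∈ M) {x : H →L[ℂ] H} (hx : x ∈ M) (hx0 : 0 ≤ x) (hx1 : x ≤ 1) :
    ∃ h ∈ N, ∀ y ∈ N, tr.τ (h * y) = tr.τ (x * y) := by
  obtain ⟨-, ψ, hψ, hτψ⟩ := hnor
  simp only [mul_one] at hτψ
  let ι := {y : H →L[ℂ] H // y ∈ N ∧ star y = y}
  let φ : ι → (H →WOT[ℂ] H) → ℝ := fun y T => (ψ (T * ContinuousLinearMapWOT.ofCLM y.1)).re
  have hφc : ∀ y, Continuous (φ y) := fun y =>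
    Complex.continuous_re.comp (hψ.comp (continuous_mul_const _))
  have hφ : ∀ y : ι, ∀ T ∈ M, φ y (ContinuousLinearMapWOT.ofCLM T) = (tr.τ (T * y.1)).re := by
    intro y T hT
    rw [hτψ _ (mul_mem hT (hNM _ y.2.1))]
    rfl
  let K : Set (H →WOT[ℂ] H) := {T | T.toCLM ∈ N ∧ 0 ≤ T.toCLM ∧ T.toCLM ≤ 1}
  have hK : IsCompact K := wot_Icc_compact N
  obtain ⟨T, hTK, hT⟩ := hK.inter_iInter_nonempty
    (fun y : ι => {T | φ y T = (tr.τ (x * y.1)).re})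
    (fun y => isClosed_eq (hφc y) continuous_const) (by
    intro u
    by_contra hcon
    let Φ : (H →L[ℂ] H) →ₗ[ℝ] (u → ℝ) :=
      { toFun := fun T j => (tr.τ (T * j.1.1)).re
        map_add' := fun T S => by
          ext j; simp [add_mul]
        map_smul' := fun c T => by
          ext j; simp [tr_rsmul] }
    let K' : Set (H →L[ℂ] H) := {T | T ∈ N ∧ 0 ≤ T ∧ T ≤ 1}
    have hK'c : Convex ℝ K' := by
      rintro S ⟨hS, hS0, hS1⟩ T ⟨hT, hT0, hT1⟩ a b ha hb hab
      refine ⟨add_mem (vn_rsmul_mem N _ hS) (vn_rsmul_mem N _ hT),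
        add_nonneg (smul_nonneg ha hS0) (smul_nonneg hb hT0), ?_⟩
      calc a • S + b • T ≤ a • 1 + b • 1 :=
            add_le_add (smul_le_smul_of_nonneg_left hS1 ha) (smul_le_smul_of_nonneg_left hT1 hb)
        _ = 1 := by rw [← add_smul, hab, one_smul]
    have himg : Φ '' K' = (fun T : H →WOT[ℂ] H => fun j : u => φ j.1 T) '' K := by
      ext w
      constructor
      · rintro ⟨T, hT, rfl⟩
        exact ⟨ContinuousLinearMapWOT.ofCLM T, hT, funext fun j => hφ _ _ (hNM _ hT.1)⟩
      · rintro ⟨T, hT, rfl⟩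
        exact ⟨T.toCLM, hT, funext fun j => (hφ _ _ (hNM _ hT.1)).symm⟩
    have hclosed : IsClosed (Φ '' K') := by
      rw [himg]
      exact (hK.image (continuous_pi fun j => hφc _)).isClosed
    have hnot : Φ x ∉ Φ '' K' := by
      rw [himg]
      rintro ⟨T, hT, hTx⟩
      refine hcon ⟨T, hT, ?_⟩
      simp only [Set.mem_iInter]
      intro i hi
      exact congrFun hTx ⟨i, hi⟩
    obtain ⟨f, c, hf1, hf2⟩ := geometric_hahn_banach_closed_point (hK'c.linear_image Φ) hclosed hnot
    let y : H →L[ℂ] H := ∑ j : u, (f (Pi.single j 1)) • (j.1.1 : H →L[ℂ] H)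
    have hyN : y ∈ N := sum_mem fun j _ => vn_rsmul_mem N _ j.1.2.1
    have hysa : star y = y := by
      simp only [y, star_sum, star_smul, star_trivial]
      exact Finset.sum_congr rfl fun j _ => by rw [j.1.2.2]
    have hfy : ∀ T, f (Φ T) = (tr.τ (T * y)).re := by
      intro T
      have e1 : Φ T = ∑ j : u, (Φ T j) • (Pi.single j 1 : u → ℝ) := by
        ext i
        rw [Finset.sum_apply]
        simp only [Pi.smul_apply, Pi.single_apply, smul_eq_mul, mul_ite, mul_one, mul_zero]
        rw [Finset.sum_ite_eq Finset.univ i]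
        simp
      rw [e1, map_sum]
      simp only [y, Finset.mul_sum, map_sum, Complex.re_sum, map_smul, mul_smul_comm]
      refine Finset.sum_congr rfl fun j _ => ?_
      rw [tr_rsmul, Complex.re_ofReal_mul, smul_eq_mul, mul_comm]
      rfl
    obtain ⟨e, heN, he0, he1, hle⟩ := exists_maximizer tr N hNM hx hx0 hx1 hyN hysa
    have h1 := hf1 _ ⟨e, ⟨heN, he0, he1⟩, rfl⟩
    rw [hfy] at h1 hf2
    linarith)
  rw [Set.mem_iInter] at hT
  have hTsa : star T.toCLM = T.toCLM := IsSelfAdjoint.of_nonneg hTK.2.1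
  have hxsa : star x = x := IsSelfAdjoint.of_nonneg hx0
  have him : ∀ w ∈ M, star w = w → ∀ y ∈ N, star y = y → (tr.τ (w * y)).im = 0 := by
    intro w hw hwsa y hy hysa
    have h1 := tr.star_eq _ (mul_mem hw (hNM _ hy))
    rw [star_mul, hwsa, hysa, tr.tracial _ (hNM _ hy) _ hw] at h1
    exact Complex.conj_eq_iff_im.1 h1.symm
  have hsa : ∀ y ∈ N, star y = y → tr.τ (T.toCLM * y) = tr.τ (x * y) := by
    intro y hy hysa
    apply Complex.ext
    · rw [← show φ ⟨y, hy, hysa⟩ T = (tr.τ (x * y)).re from hT ⟨y, hy, hysa⟩]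
      exact (hφ ⟨y, hy, hysa⟩ T.toCLM (hNM _ hTK.1)).symm
    · rw [him _ (hNM _ hTK.1) hTsa y hy hysa, him _ hx hxsa y hy hysa]
  refine ⟨T.toCLM, hTK.1, fun y hy => ?_⟩
  have hstar := vn_star_mem N hy
  have hy1 : y + star y ∈ N := add_mem hy hstar
  have hy2 : Complex.I • (y - star y) ∈ N := vn_smul_mem N _ (sub_mem hy hstar)
  have h1 := hsa _ hy1 (by simp [add_comm])
  have h2 := hsa _ hy2 (by
    rw [star_smul, star_sub, star_star]
    simp only [Complex.star_def, Complex.conj_I]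
    module)
  rw [mul_smul_comm, mul_smul_comm, map_smul, map_smul, smul_eq_mul, smul_eq_mul] at h2
  have h3 := mul_left_cancel₀ Complex.I_ne_zero h2
  rw [mul_add, mul_add, map_add, map_add] at h1
  rw [mul_sub, mul_sub, map_sub, map_sub] at h3
  linear_combination (1 / 2) * h1 + (1 / 2) * h3

theorem cexp_exists (tr : TraceOn H (M : Set (H →L[ℂ] H))) (hnor : InJ tr 1)
    (N : VonNeumannAlgebra H) (hNM : ∀ x ∈ N, x ∈ M) {x : H →L[ℂ] H} (hx : x ∈ M) :
    ∃ h ∈ N, ∀ y ∈ N, tr.τ (h * y) = tr.τ (x * y) := by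
  have hsa : ∀ x ∈ M, star x = x → ∃ h ∈ N, ∀ y ∈ N, tr.τ (h * y) = tr.τ (x * y) := by
    intro x hx hxsa
    have hs : IsSelfAdjoint x := hxsa
    set k : ℝ := ‖x‖ + 1 with hk
    have hk0 : 0 < k := by positivity
    have hl : -(k • (1 : H →L[ℂ] H)) ≤ x := by
      have h1 := hs.neg_algebraMap_norm_le_self
      rw [Algebra.algebraMap_eq_smul_one] at h1
      refine le_trans ?_ h1
      rw [neg_le_neg_iff]
      exact smul_le_smul_of_nonneg_right (by rw [hk]; linarith) zero_le_one
    have hu : x ≤ k • (1 : H →L[ℂ] H) := by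
      have h1 := hs.le_algebraMap_norm_self
      rw [Algebra.algebraMap_eq_smul_one] at h1
      refine h1.trans ?_
      exact smul_le_smul_of_nonneg_right (by rw [hk]; linarith) zero_le_one
    have hinv : (0 : ℝ) ≤ (2 * k)⁻¹ := by positivity
    have hkk : (2 * k)⁻¹ * k = 1 / 2 := by field_simp
    obtain ⟨h, hhN, hh⟩ := cexp_Icc tr hnor N hNM (x := (2 * k)⁻¹ • (x + k • 1))
      (vn_rsmul_mem M _ (add_mem hx (vn_rsmul_one_mem M k)))
      (smul_nonneg hinv (by rw [← sub_neg_eq_add]; exact sub_nonneg.2 hl))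
      (by
        have h1 : x + k • (1 : H →L[ℂ] H) ≤ (2 * k) • 1 := by
          rw [two_mul, add_smul k k]
          exact add_le_add hu le_rfl
        have h2 := smul_le_smul_of_nonneg_left h1 hinv
        rwa [smul_smul, inv_mul_cancel₀ (by positivity), one_smul] at h2)
    refine ⟨(2 * k) • h - k • 1, sub_mem (vn_rsmul_mem N _ hhN) (vn_rsmul_one_mem N k), ?_⟩
    intro y hy
    have h1 := hh y hy
    rw [smul_mul_assoc, add_mul, tr_rsmul, map_add, smul_mul_assoc, tr_rsmul, one_mul] at h1
    rw [sub_mul, map_sub, smul_mul_assoc, smul_mul_assoc, tr_rsmul, tr_rsmul, one_mul, h1]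
    push_cast
    have : (k : ℂ) ≠ 0 := by exact_mod_cast hk0.ne'
    field_simp
    ring
  have hstar := vn_star_mem M hx
  obtain ⟨a, ha, ha2⟩ := hsa (x + star x) (add_mem hx hstar) (by simp [add_comm])
  obtain ⟨b, hb, hb2⟩ := hsa (Complex.I • (x - star x)) (vn_smul_mem M _ (sub_mem hx hstar)) (by
    rw [star_smul, star_sub, star_star]
    simp only [Complex.star_def, Complex.conj_I]
    module)
  refine ⟨(1 / 2 : ℂ) • a + (-(1 / 2) * Complex.I : ℂ) • b,
    add_mem (vn_smul_mem N _ ha) (vn_smul_mem N _ hb), fun y hy => ?_⟩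
  have h1 := ha2 y hy
  have h2 := hb2 y hy
  rw [add_mul, map_add] at h1
  rw [smul_mul_assoc, map_smul, smul_eq_mul, sub_mul, map_sub] at h2
  rw [add_mul, map_add, smul_mul_assoc, smul_mul_assoc, map_smul, map_smul, smul_eq_mul,
    smul_eq_mul, h1, h2]
  linear_combination (-(1 / 2) * (tr.τ (x * y) - tr.τ (star x * y))) * Complex.I_mul_I

end CondExp

end CD

namespace CD

section Main

variable {H : Type} [NormedAddCommGroup H] [InnerProductSpace ℂ H] [CompleteSpace H]
variable {Γ : Type} [Group Γ]

open ContinuousLinearMap Filter Topology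
open scoped InnerProductSpace

/-- The conditional expectation onto `N`, characterised by the trace. -/
structure CE (X : CrossedProduct Γ H) (N : VonNeumannAlgebra H) where
  E : (H →L[ℂ] H) → (H →L[ℂ] H)
  sub : ∀ x ∈ N, x ∈ X.M
  mem : ∀ x ∈ X.M, E x ∈ N
  trE : ∀ x ∈ X.M, ∀ y ∈ N, X.tr.τ (E x * y) = X.tr.τ (x * y)

variable {X : CrossedProduct Γ H} {N : VonNeumannAlgebra H} (e : CE X N)

lemma CE.memM {x : H →L[ℂ] H} (hx : x ∈ X.M) : e.E x ∈ X.M := e.sub _ (e.mem _ hx)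

lemma CE.unique {w x : H →L[ℂ] H} (hw : w ∈ N) (hx : x ∈ X.M)
    (h : ∀ y ∈ N, X.tr.τ (w * y) = X.tr.τ (x * y)) : e.E x = w := by
  have hd : e.E x - w ∈ N := sub_mem (e.mem _ hx) hw
  have hs := vn_star_mem N hd
  rw [← sub_eq_zero]
  refine X.tr.faithful _ (e.sub _ hd) ?_
  rw [X.tr.tracial _ (e.sub _ hs) _ (e.sub _ hd), sub_mul, map_sub, e.trE _ hx _ hs, h _ hs,
    sub_self]

lemma CE.fix {x : H →L[ℂ] H} (hx : x ∈ N) : e.E x = x :=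
  e.unique hx (e.sub _ hx) fun _ _ => rfl

lemma CE.left {a x : H →L[ℂ] H} (ha : a ∈ N) (hx : x ∈ X.M) : e.E (a * x) = a * e.E x := by
  refine e.unique (mul_mem ha (e.mem _ hx)) (mul_mem (e.sub _ ha) hx) fun y hy => ?_
  have haM := e.sub _ ha
  have hyM := e.sub _ hy
  rw [mul_assoc, mul_assoc, X.tr.tracial _ haM _ (mul_mem (e.memM hx) hyM),
    X.tr.tracial _ haM _ (mul_mem hx hyM), mul_assoc, mul_assoc, e.trE _ hx _ (mul_mem hy ha)]

lemma CE.right {a x : H →L[ℂ] H} (ha : a ∈ N) (hx : x ∈ X.M) : e.E (x * a) = e.E x * a := by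
  refine e.unique (mul_mem (e.mem _ hx) ha) (mul_mem hx (e.sub _ ha)) fun y hy => ?_
  rw [mul_assoc, mul_assoc, e.trE _ hx _ (mul_mem ha hy)]

lemma CE.sub_map {x y : H →L[ℂ] H} (hx : x ∈ X.M) (hy : y ∈ X.M) :
    e.E (x - y) = e.E x - e.E y := by
  refine e.unique (sub_mem (e.mem _ hx) (e.mem _ hy)) (sub_mem hx hy) fun z hz => ?_
  rw [sub_mul, sub_mul, map_sub, map_sub, e.trE _ hx _ hz, e.trE _ hy _ hz]

lemma CE.sum_map {ι : Type*} (s : Finset ι) (f : ι → H →L[ℂ] H) (hf : ∀ i, f i ∈ X.M) :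
    e.E (∑ i ∈ s, f i) = ∑ i ∈ s, e.E (f i) := by
  refine e.unique (sum_mem fun i _ => e.mem _ (hf i)) (sum_mem fun i _ => hf i) fun z hz => ?_
  rw [Finset.sum_mul, Finset.sum_mul, map_sum, map_sum]
  exact Finset.sum_congr rfl fun i _ => e.trE _ (hf i) _ hz

lemma CE.smul_map (c : ℂ) {x : H →L[ℂ] H} (hx : x ∈ X.M) : e.E (c • x) = c • e.E x := by
  refine e.unique (vn_smul_mem N c (e.mem _ hx)) (vn_smul_mem X.M c hx) fun z hz => ?_
  rw [smul_mul_assoc, smul_mul_assoc, map_smul, map_smul, e.trE _ hx _ hz]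

lemma CE.contr {x : H →L[ℂ] H} (hx : x ∈ X.M) : X.tr.norm2 (e.E x) ≤ X.tr.norm2 x := by
  have hE := e.memM hx
  have hs := vn_star_mem N (e.mem _ hx)
  have h1 : X.tr.norm2 (e.E x) ^ 2 ≤ X.tr.norm2 (e.E x) * X.tr.norm2 x := by
    rw [norm2_sq X.tr hE, X.tr.tracial _ (e.sub _ hs) _ hE, e.trE _ hx _ hs,
      X.tr.tracial _ hx _ (e.sub _ hs)]
    exact (Complex.re_le_norm _).trans (tr_cs X.tr hE hx)
  rcases (norm2_nonneg X.tr (e.E x)).eq_or_lt with h | h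
  · rw [← h]; exact norm2_nonneg _ _
  · exact le_of_mul_le_mul_left (by rw [← sq]; exact h1) h

lemma CE.sigma (hu : ∀ g, X.u g ∈ N) {x : H →L[ℂ] H} (hx : x ∈ X.M) (g : Γ) :
    e.E (X.σ g x) = X.σ g (e.E x) := by
  unfold CrossedProduct.σ
  rw [e.right (vn_star_mem N (hu g)) (mul_mem (X.u_mem g) hx), e.left (hu g) hx]

lemma norm2_mul_ustar {y : H →L[ℂ] H} (hy : y ∈ X.M) (g : Γ) :
    X.tr.norm2 (y * star (X.u g)) = X.tr.norm2 y := by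
  rw [← norm2_star X.tr (mul_mem hy (ustar_mem X g)), ← norm2_star X.tr hy, star_mul, star_star]
  unfold TraceOn.norm2
  rw [star_mul, mul_assoc, ← mul_assoc (star (X.u g)), u_star_mul, one_mul]

lemma norm2_coef_le {y : H →L[ℂ] H} (hy : y ∈ X.M) (g : Γ) :
    X.tr.norm2 (coef X y g) ≤ X.tr.norm2 y :=
  (X.EA.contractive _ (mul_mem hy (ustar_mem X g))).trans (norm2_mul_ustar hy g).le

lemma coef_small (hicc : IsICC Γ) {A₀ : VonNeumannAlgebra H} (hA₀ : ∀ x ∈ A₀, x ∈ X.A)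
    (hA₀N : ∀ x ∈ A₀, x ∈ N) (hu : ∀ g, X.u g ∈ N)
    {f : H →L[ℂ] H} (hf : f ∈ X.A)
    (hap : ∀ ε : ℝ, 0 < ε → ∃ (n : ℕ) (ξ : Fin n → (H →L[ℂ] H)) (C : ℝ),
      (∀ i, ξ i ∈ X.A) ∧
      ∀ γ : Γ, ∃ κ : Fin n → (H →L[ℂ] H), (∀ i, κ i ∈ A₀) ∧ (∀ i, ‖κ i‖ ≤ C) ∧
        X.tr.norm2 (X.σ γ f - ∑ i, κ i * ξ i) ≤ ε)
    {h : Γ} (hh : h ≠ 1) : coef X (e.E f) h = 0 := by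
  have hfM := A_mem_M X hf
  have hbM := e.memM hfM
  refine norm2_eq_zero X.tr (coef_memM X hbM h) (le_antisymm ?_ (norm2_nonneg _ _))
  refine le_of_forall_pos_le_add fun ε hε => ?_
  rw [zero_add]
  obtain ⟨n, ξ, C, hξ, hκ⟩ := hap (ε / 2) (by positivity)
  have hξM : ∀ i, ξ i ∈ X.M := fun i => A_mem_M X (hξ i)
  set δ : ℝ := ε / 2 / ((n + 1) * (|C| + 1)) with hδ
  have hδ0 : 0 < δ := by positivity
  obtain ⟨g, ⟨γ, rfl⟩, hg⟩ := exists_small X (fun i => e.E (ξ i)) (fun i => e.memM (hξM i)) hδ0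
    (hicc h hh)
  obtain ⟨κ, hκ0, hκC, hle⟩ := hκ γ
  have hκM : ∀ i, κ i ∈ X.M := fun i => A_mem_M X (hA₀ _ (hκ0 i))
  have hσf := sigma_mem X hfM γ
  have hsumM : ∑ i, κ i * ξ i ∈ X.M := sum_mem fun i _ => mul_mem (hκM i) (hξM i)
  set d := X.σ γ f - ∑ i, κ i * ξ i with hd
  have hdM : d ∈ X.M := sub_mem hσf hsumM
  set g := γ * h * γ⁻¹ with hgdef
  have hsplit : X.σ γ (e.E f) = e.E d + ∑ i, κ i * e.E (ξ i) := by
    rw [hd, e.sub_map hσf hsumM, e.sigma hu hfM,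
      e.sum_map _ _ (fun i => mul_mem (hκM i) (hξM i))]
    simp only [fun i => e.left (hA₀N _ (hκ0 i)) (hξM i)]
    abel
  have hcs : coef X (X.σ γ (e.E f)) g
      = coef X (e.E d) g + ∑ i, κ i * coef X (e.E (ξ i)) g := by
    rw [hsplit]
    unfold coef
    rw [add_mul, map_add, Finset.sum_mul, map_sum]
    congr 1
    refine Finset.sum_congr rfl fun i _ => ?_
    rw [mul_assoc, EA_left X (hA₀ _ (hκ0 i)) (mul_mem (e.memM (hξM i)) (ustar_mem X g))]
  have hterm : ∀ i, X.tr.norm2 (κ i * coef X (e.E (ξ i)) g) ≤ (|C| + 1) * δ := by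
    intro i
    refine (norm2_mul_le X.tr (hκM i) (coef_memM X (e.memM (hξM i)) g)).trans ?_
    refine mul_le_mul ?_ (hg i).le (norm2_nonneg _ _) (by positivity)
    have := hκC i
    have := le_abs_self C
    linarith
  have hmem : ∀ i, κ i * coef X (e.E (ξ i)) g ∈ X.M := fun i =>
    mul_mem (hκM i) (coef_memM X (e.memM (hξM i)) g)
  calc X.tr.norm2 (coef X (e.E f) h) = X.tr.norm2 (X.σ γ (coef X (e.E f) h)) :=
        (norm2_sigma X (coef_memM X hbM h) γ).symm
    _ = X.tr.norm2 (coef X (X.σ γ (e.E f)) g) := by rw [hgdef, coef_conj X hbM]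
    _ ≤ X.tr.norm2 (coef X (e.E d) g) + X.tr.norm2 (∑ i, κ i * coef X (e.E (ξ i)) g) := by
        rw [hcs]
        exact norm2_add_le X.tr (coef_memM X (e.memM hdM) g) (sum_mem fun i _ => hmem i)
    _ ≤ ε / 2 + ∑ i : Fin n, (|C| + 1) * δ := by
        refine add_le_add ?_ ?_
        · exact (norm2_coef_le (e.memM hdM) g).trans ((e.contr hdM).trans hle)
        · exact (norm2_sum_le X.tr _ _ hmem).trans (Finset.sum_le_sum fun i _ => hterm i)
    _ ≤ ε := by
        rw [Finset.sum_const, Finset.card_univ, Fintype.card_fin, nsmul_eq_mul]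
        have h1 : ((n : ℝ) + 1) * ((|C| + 1) * δ) = ε / 2 := by
          rw [hδ]; field_simp
        have h2 : 0 ≤ (|C| + 1) * δ := by positivity
        nlinarith

lemma E_A_mem (hicc : IsICC Γ) {A₀ : VonNeumannAlgebra H} (hA₀ : ∀ x ∈ A₀, x ∈ X.A)
    (hA₀N : ∀ x ∈ A₀, x ∈ N) (hu : ∀ g, X.u g ∈ N)
    (hcpt : IsCompactExt X (A₀ : Set (H →L[ℂ] H)) (X.A : Set (H →L[ℂ] H)))
    {a : H →L[ℂ] H} (ha : a ∈ X.A) : e.E a ∈ X.A := by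
  obtain ⟨F, hFA, hdense, hap⟩ := hcpt
  have hF : ∀ f ∈ F, e.E f = X.EA.E (e.E f) := fun f hf =>
    eq_EA_of_coef X (e.memM (A_mem_M X (hFA hf))) fun h hh =>
      coef_small e hicc hA₀ hA₀N hu (hFA hf) (hap f hf) hh
  have haM := A_mem_M X ha
  have hbM := e.memM haM
  have hEb := EA_mem X hbM
  have key : e.E a - X.EA.E (e.E a) = 0 := by
    refine norm2_eq_zero X.tr (sub_mem hbM (A_mem_M X hEb))
      (le_antisymm ?_ (norm2_nonneg _ _))
    refine le_of_forall_pos_le_add fun ε hε => ?_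
    rw [zero_add]
    obtain ⟨n, c, f, hf, hle⟩ := hdense a ha (ε / 2) (by positivity)
    have hfM : ∀ i, c i • f i ∈ X.M := fun i =>
      vn_smul_mem X.M _ (A_mem_M X (hFA (hf i)))
    have hsM : ∑ i, c i • f i ∈ X.M := sum_mem fun i _ => hfM i
    have hs : e.E (∑ i, c i • f i) = X.EA.E (e.E (∑ i, c i • f i)) := by
      rw [e.sum_map _ _ hfM, map_sum]
      refine Finset.sum_congr rfl fun i _ => ?_
      rw [e.smul_map _ (A_mem_M X (hFA (hf i))), map_smul, ← hF _ (hf i)]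
    have hdM := sub_mem haM hsM
    set d := a - ∑ i, c i • f i with hd
    have h1 : e.E a - X.EA.E (e.E a) = e.E d - X.EA.E (e.E d) := by
      rw [hd, e.sub_map haM hsM, map_sub, ← hs]
      abel
    rw [h1]
    have h2 := norm2_sub_le X.tr (e.memM hdM) (A_mem_M X (EA_mem X (e.memM hdM)))
    have h3 := X.EA.contractive _ (e.memM hdM)
    have h4 := e.contr hdM
    linarith
  rw [sub_eq_zero.1 key]
  exact hEb

lemma comm_square (hEA : ∀ a ∈ X.A, e.E a ∈ X.A) {x : H →L[ℂ] H} (hx : x ∈ X.M) :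
    X.EA.E (e.E x) = e.E (X.EA.E x) := by
  have hEx := EA_mem X hx
  have hExM := A_mem_M X hEx
  have hN : e.E x ∈ X.M := e.memM hx
  have hsym : ∀ w ∈ X.M, ∀ z ∈ X.M, X.tr.τ (e.E w * z) = X.tr.τ (w * e.E z) := by
    intro w hw z hz
    rw [← e.trE w hw _ (e.mem _ hz), X.tr.tracial _ (e.memM hw) _ hz,
      X.tr.tracial _ (e.memM hw) _ (e.memM hz), e.trE z hz _ (e.mem _ hw)]
  have hsymA : ∀ w ∈ X.M, ∀ z ∈ X.M, X.tr.τ (X.EA.E w * z) = X.tr.τ (w * X.EA.E z) := by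
    intro w hw z hz
    rw [← tr_EA_left X (EA_mem X hw) hz, tr_EA_right X (EA_mem X hz) hw]
  rw [← sub_eq_zero]
  refine tr_sep X.tr (sub_mem (A_mem_M X (EA_mem X hN)) (e.memM hExM)) fun y hy => ?_
  have hy' := EA_mem X hy
  rw [sub_mul, map_sub, sub_eq_zero, hsymA _ hN _ hy, hsym _ hx _ (A_mem_M X hy'),
    ← tr_EA_right X (hEA _ hy') hx, ← hsym _ hExM _ (A_mem_M X hy'),
    tr_EA_left X (hEA _ hEx) hy]

/-- Intersection of von Neumann algebras. -/
def vnInf (P Q : VonNeumannAlgebra H) : VonNeumannAlgebra H where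
  toStarSubalgebra := P.toStarSubalgebra ⊓ Q.toStarSubalgebra
  centralizer_centralizer' := by
    refine Set.Subset.antisymm ?_ Set.subset_centralizer_centralizer
    intro x hx
    refine ⟨?_, ?_⟩
    · refine (P.centralizer_centralizer' ▸ ?_ : x ∈ P.carrier)
      exact Set.centralizer_subset (Set.centralizer_subset fun y hy => hy.1) hx
    · refine (Q.centralizer_centralizer' ▸ ?_ : x ∈ Q.carrier)
      exact Set.centralizer_subset (Set.centralizer_subset fun y hy => hy.2) hx

lemma mem_vnInf {P Q : VonNeumannAlgebra H} {x : H →L[ℂ] H} :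
    x ∈ vnInf P Q ↔ x ∈ P ∧ x ∈ Q := Iff.rfl

theorem main_aux (hicc : IsICC Γ) (X : CrossedProduct Γ H) (herg : IsErgodic X)
    (A₀ : VonNeumannAlgebra H)
    (hA₀ : (A₀ : Set (H →L[ℂ] H)) ⊆ (X.A : Set (H →L[ℂ] H)))
    (hcpt : IsCompactExt X (A₀ : Set (H →L[ℂ] H)) (X.A : Set (H →L[ℂ] H)))
    (N : VonNeumannAlgebra H)
    (hN₁ : midCP X (A₀ : Set (H →L[ℂ] H)) ⊆ (N : Set (H →L[ℂ] H)))
    (hN₂ : (N : Set (H →L[ℂ] H)) ⊆ (X.M : Set (H →L[ℂ] H))) :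
    ∃ Z : VonNeumannAlgebra H,
      (A₀ : Set (H →L[ℂ] H)) ⊆ (Z : Set (H →L[ℂ] H)) ∧
      (Z : Set (H →L[ℂ] H)) ⊆ (X.A : Set (H →L[ℂ] H)) ∧
      InvariantUnder X (Z : Set (H →L[ℂ] H)) ∧
      (N : Set (H →L[ℂ] H)) = midCP X (Z : Set (H →L[ℂ] H)) := by
  have hEu : ∀ g : Γ, X.EA.E (X.u g) ∈ A₀ := by
    intro g
    by_cases hg : g = 1
    · rw [hg, X.u_one, X.EA.fix _ (one_mem X.A)]
      exact one_mem A₀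
    · rw [X.EA_u g hg]
      exact zero_mem A₀
  have hu : ∀ g, X.u g ∈ N := by
    intro g
    refine hN₁ ⟨X.u_mem g, fun k => ?_⟩
    rw [X.u_star, X.u_mul]
    exact hEu _
  have hA₀N : ∀ x ∈ A₀, x ∈ N := by
    intro x hx
    refine hN₁ ⟨A_mem_M X (hA₀ hx), fun k => ?_⟩
    rw [EA_left X (hA₀ hx) (ustar_mem X k), X.u_star]
    exact mul_mem hx (hEu _)
  have hnor := normal_of_factor X.tr (isFactor X hicc herg)
  have hex : ∀ x, ∃ h, x ∈ X.M → (h ∈ N ∧ ∀ y ∈ N, X.tr.τ (h * y) = X.tr.τ (x * y)) := by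
    intro x
    by_cases hx : x ∈ X.M
    · obtain ⟨h, h1, h2⟩ := cexp_exists X.tr hnor N (fun x hx => hN₂ hx) hx
      exact ⟨h, fun _ => ⟨h1, h2⟩⟩
    · exact ⟨0, fun h => absurd h hx⟩
  choose E hE using hex
  let e : CE X N := ⟨E, fun x hx => hN₂ hx, fun x hx => (hE x hx).1, fun x hx => (hE x hx).2⟩
  have hEA : ∀ a ∈ X.A, e.E a ∈ X.A := fun a ha =>
    E_A_mem e hicc (fun x hx => hA₀ hx) hA₀N hu hcpt ha
  refine ⟨vnInf N X.A, fun x hx => ⟨hA₀N x hx, hA₀ hx⟩, fun x hx => hx.2, ?_, ?_⟩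
  · intro g q hq
    exact ⟨mul_mem (mul_mem (hu g) hq.1) (vn_star_mem N (hu g)), X.conj_mem g q hq.2⟩
  · refine Set.Subset.antisymm ?_ ?_
    · intro x hx
      refine ⟨hN₂ hx, fun g => ?_⟩
      have hy : x * star (X.u g) ∈ N := mul_mem hx (vn_star_mem N (hu g))
      have hyM := e.sub _ hy
      refine mem_vnInf.2 ⟨?_, EA_mem X hyM⟩
      have h1 := comm_square e hEA hyM
      rw [e.fix hy] at h1
      rw [h1]
      exact e.mem _ (A_mem_M X (EA_mem X hyM))
    · rintro x ⟨hxM, hx⟩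
      have h0 : x - e.E x = 0 := by
        refine X.fourier_sep _ (sub_mem hxM (e.memM hxM)) fun g => ?_
        have hyM := mul_mem hxM (ustar_mem X g)
        rw [sub_mul, map_sub, ← e.right (vn_star_mem N (hu g)) hxM, comm_square e hEA hyM,
          e.fix (mem_vnInf.1 (hx g)).1, sub_self]
      rw [sub_eq_zero.1 h0]
      exact e.mem _ hxM

end Main

end CD

open CD in
/-- Theorem `main3`. Let `Γ` be an icc countable group, `Γ ↷ X₀` a pmp
action and `Γ ↷ X` an ergodic compact extension of it. Then every intermediate von
Neumann subalgebra `L^∞(X₀) ⋊ Γ ⊆ N ⊆ L^∞(X) ⋊ Γ` is of the form `N = L^∞(Z) ⋊ Γ` for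
an intermediate extension `Γ ↷ Z`; intermediate extensions correspond bijectively to
`Γ`-invariant intermediate von Neumann subalgebras `L^∞(X₀) ⊆ L^∞(Z) ⊆ L^∞(X)`, which
is how we state the conclusion. Here `X.A` plays the role of `L^∞(X)` (pmp actions on
probability spaces are modelled by trace-preserving actions on abelian von Neumann
algebras). -/
theorem stmt1_compact_extension_intermediate_extensions
    (Γ : Type) [Group Γ] [Countable Γ] (hicc : IsICC Γ)
    (H : Type) [NormedAddCommGroup H] [InnerProductSpace ℂ H] [CompleteSpace H]
    -- the group measure space algebra `L^∞(X) ⋊ Γ`, with `X.A = L^∞(X)` abelian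
    (X : CrossedProduct Γ H)
    (habel : IsAbelianSet (X.A : Set (H →L[ℂ] H)))
    -- `Γ ↷ X` is ergodic
    (herg : IsErgodic X)
    -- the quotient pmp action `Γ ↷ X₀`, i.e. a `Γ`-invariant subalgebra `L^∞(X₀) ⊆ L^∞(X)`
    (A₀ : VonNeumannAlgebra H)
    (hA₀ : (A₀ : Set (H →L[ℂ] H)) ⊆ (X.A : Set (H →L[ℂ] H)))
    (hA₀inv : InvariantUnder X (A₀ : Set (H →L[ℂ] H)))
    -- `Γ ↷ X` is a compact extension of `Γ ↷ X₀`
    (hcpt : IsCompactExt X (A₀ : Set (H →L[ℂ] H)) (X.A : Set (H →L[ℂ] H)))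
    -- an intermediate von Neumann subalgebra `L^∞(X₀) ⋊ Γ ⊆ N ⊆ L^∞(X) ⋊ Γ`
    (N : VonNeumannAlgebra H)
    (hN₁ : midCP X (A₀ : Set (H →L[ℂ] H)) ⊆ (N : Set (H →L[ℂ] H)))
    (hN₂ : (N : Set (H →L[ℂ] H)) ⊆ (X.M : Set (H →L[ℂ] H))) :
    -- there is an intermediate extension `Γ ↷ Z`, i.e. a `Γ`-invariant intermediate
    -- subalgebra `L^∞(X₀) ⊆ L^∞(Z) ⊆ L^∞(X)`, with `N = L^∞(Z) ⋊ Γ`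
    ∃ Z : VonNeumannAlgebra H,
      (A₀ : Set (H →L[ℂ] H)) ⊆ (Z : Set (H →L[ℂ] H)) ∧
      (Z : Set (H →L[ℂ] H)) ⊆ (X.A : Set (H →L[ℂ] H)) ∧
      InvariantUnder X (Z : Set (H →L[ℂ] H)) ∧
      (N : Set (H →L[ℂ] H)) = midCP X (Z : Set (H →L[ℂ] H)) := by
  exact main_aux hicc X herg A₀ hA₀ hcpt N hN₁ hN₂
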